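/- For every $\alpha\in(-\log s_1,-\log s_2)$, the Hausdorff dimension of the level set $X_\nu(\alpha)\subseteq[0,1]$ equals $\min\{\theta_a^\ast(\alpha),\theta_b^\ast(\alpha)\}$. -/

import Mathlib

open MeasureTheory Metric Set Filter Topology Classical
open scoped ENNReal NNReal

noncomputable section

namespace MF

/-! ### Olsen's multifractal measures and dimension functions on a metric space -/

variable {X : Type} [MetricSpace X]

/-- The sum `∑ m(B(xᵢ,rᵢ))^q (2rᵢ)^t` associated with a countable family of centered balls. -/
def olsenSum [MeasurableSpace X] (m : Measure X) (q t : ℝ) {ι : Type}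
    (c : ι → X) (r : ι → ℝ) : ℝ≥0∞ :=
  ∑' i, m (closedBall (c i) (r i)) ^ q * ENNReal.ofReal (2 * r i) ^ t

/-- `Olsen's 𝓗^{q,t}_{m,δ}`: infimum over countable centered `δ`-coverings of `E`. -/
def Hdel [MeasurableSpace X] (m : Measure X) (q t δ : ℝ) (E : Set X) : ℝ≥0∞ :=
  ⨅ (ι : Type) (_ : Countable ι) (c : ι → X) (r : ι → ℝ)
    (_ : ∀ i, c i ∈ E) (_ : ∀ i, 0 < r i ∧ r i ≤ δ)
    (_ : E ⊆ ⋃ i, closedBall (c i) (r i)), olsenSum m q t c r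

/-- Olsen's premeasure `𝓗̄^{q,t}_m` (limit, i.e. supremum, as `δ ↓ 0`). -/
def Hpre [MeasurableSpace X] (m : Measure X) (q t : ℝ) (E : Set X) : ℝ≥0∞ :=
  ⨆ (δ : ℝ) (_ : 0 < δ), Hdel m q t δ E

/-- Olsen's multifractal Hausdorff measure `𝓗^{q,t}_m`. -/
def Hmeas [MeasurableSpace X] (m : Measure X) (q t : ℝ) (E : Set X) : ℝ≥0∞ :=
  ⨆ (F : Set X) (_ : F ⊆ E), Hpre m q t F

/-- `𝓟̄^{q,t}_{m,δ}`: supremum over countable centered `δ`-packings of `E`. -/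
def Pdel [MeasurableSpace X] (m : Measure X) (q t δ : ℝ) (E : Set X) : ℝ≥0∞ :=
  ⨆ (ι : Type) (_ : Countable ι) (c : ι → X) (r : ι → ℝ)
    (_ : ∀ i, c i ∈ E) (_ : ∀ i, 0 < r i ∧ r i ≤ δ)
    (_ : ∀ i j, i ≠ j → Disjoint (closedBall (c i) (r i)) (closedBall (c j) (r j))),
    olsenSum m q t c r

/-- Olsen's packing premeasure `𝓟̄^{q,t}_m` (limit, i.e. infimum, as `δ ↓ 0`). -/
def Ppre [MeasurableSpace X] (m : Measure X) (q t : ℝ) (E : Set X) : ℝ≥0∞ :=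
  ⨅ (δ : ℝ) (_ : 0 < δ), Pdel m q t δ E

/-- Olsen's multifractal packing measure `𝓟^{q,t}_m`. -/
def Pmeas [MeasurableSpace X] (m : Measure X) (q t : ℝ) (E : Set X) : ℝ≥0∞ :=
  ⨅ (En : ℕ → Set X) (_ : E ⊆ ⋃ n, En n), ∑' n, Ppre m q t (En n)

/-- The (topological) support of a measure on a metric space. -/
def msupport [MeasurableSpace X] (m : Measure X) : Set X :=
  {x | ∀ r : ℝ, 0 < r → 0 < m (ball x r)}

/-- Olsen's multifractal Hausdorff dimension function `b_m`. -/
def bFun [MeasurableSpace X] (m : Measure X) (q : ℝ) : ℝ :=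
  sInf {t | Hmeas m q t (msupport m) = 0}

/-- Olsen's multifractal packing dimension function `B_m`. -/
def BFun [MeasurableSpace X] (m : Measure X) (q : ℝ) : ℝ :=
  sInf {t | Pmeas m q t (msupport m) = 0}

/-- Olsen's function `τ_m`. -/
def tauFun [MeasurableSpace X] (m : Measure X) (q : ℝ) : ℝ :=
  sInf {t | Ppre m q t (msupport m) = 0}

/-- `t`-dimensional packing pre-premeasure at scale `δ`. -/
def pPdel (t δ : ℝ) (E : Set X) : ℝ≥0∞ :=
  ⨆ (ι : Type) (_ : Countable ι) (c : ι → X) (r : ι → ℝ)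
    (_ : ∀ i, c i ∈ E) (_ : ∀ i, 0 < r i ∧ r i ≤ δ)
    (_ : ∀ i j, i ≠ j → Disjoint (closedBall (c i) (r i)) (closedBall (c j) (r j))),
    ∑' i, ENNReal.ofReal (2 * r i) ^ t

/-- `t`-dimensional packing premeasure. -/
def pPpre (t : ℝ) (E : Set X) : ℝ≥0∞ := ⨅ (δ : ℝ) (_ : 0 < δ), pPdel t δ E

/-- `t`-dimensional packing measure. -/
def pPmeas (t : ℝ) (E : Set X) : ℝ≥0∞ :=
  ⨅ (En : ℕ → Set X) (_ : E ⊆ ⋃ n, En n), ∑' n, pPpre t (En n)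

/-- Packing dimension of a set. -/
def packDim (E : Set X) : ℝ := sInf {t | pPmeas t E = 0}

/-- The level set `X_m(α)` of points of the support where the local Hölder exponent is `α`. -/
def Xlev [MeasurableSpace X] (m : Measure X) (α : ℝ) : Set X :=
  {x | x ∈ msupport m ∧
    Tendsto (fun r => Real.log (m (closedBall x r)).toReal / Real.log r)
      (𝓝[>] (0 : ℝ)) (𝓝 α)}

/-- Legendre transform `f^*(x) = inf_y (xy + f(y))`. -/
def leg (f : ℝ → ℝ) (x : ℝ) : ℝ := ⨅ y : ℝ, (x * y + f y)

/-! ### The mixed symbolic space and inhomogeneous multinomial measures -/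

/-- `j` is an index governed by the first alphabet:
`T (2k-1) ≤ j < T (2k)` for some `k ≥ 1`. -/
def isA (T : ℕ → ℕ) (j : ℕ) : Prop :=
  ∃ k, 1 ≤ k ∧ T (2 * k - 1) ≤ j ∧ j < T (2 * k)

/-- The size of the alphabet at (0-based) position `n`, i.e. at paper index `j = n+1`. -/
def Yc (c₁ c₂ : ℕ) (T : ℕ → ℕ) (n : ℕ) : ℕ := if isA T (n + 1) then c₁ else c₂

/-- The mixed symbolic space `∂𝒜₁,₂* = ∏ⱼ Yⱼ`. -/
abbrev Omg (c₁ c₂ : ℕ) (T : ℕ → ℕ) : Type := ∀ n : ℕ, Fin (Yc c₁ c₂ T n)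

/-- Finite words of length `n`. -/
abbrev Word (c₁ c₂ : ℕ) (T : ℕ → ℕ) (n : ℕ) : Type :=
  ∀ i : Fin n, Fin (Yc c₁ c₂ T i.val)

/-- `N_n`: the number of indices `1 ≤ j ≤ n` governed by the first alphabet. -/
def Ncount (T : ℕ → ℕ) (n : ℕ) : ℕ := ((Finset.Icc 1 n).filter (isA T)).card

/-- Diameter `c₁^{-N_n} c₂^{-(n-N_n)}` of a cylinder of generation `n`. -/
def Dw (c₁ c₂ : ℕ) (T : ℕ → ℕ) (n : ℕ) : ℝ :=
  ((c₁ : ℝ) ^ Ncount T n * (c₂ : ℝ) ^ (n - Ncount T n))⁻¹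

/-- The cylinder `[w]` defined by a finite word `w`. -/
def cyl (c₁ c₂ : ℕ) (T : ℕ → ℕ) (n : ℕ) (w : Word c₁ c₂ T n) : Set (Omg c₁ c₂ T) :=
  {x | ∀ i : Fin n, x i.val = w i}

/-- The mass `∏_{j≤n} p_j` given to the cylinder `[w]` by the inhomogeneous
multinomial measure with weights `a` and `b`. -/
def cylWeight (c₁ c₂ : ℕ) (T : ℕ → ℕ) (a b : ℕ → ℝ) (n : ℕ) (w : Word c₁ c₂ T n) : ℝ :=
  ∏ i : Fin n, (if isA T (i.val + 1) then a (w i).val else b (w i).val)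

/-- `θ(q) = log_c (p₁^q + ⋯ + p_c^q)`. -/
def theta (c : ℕ) (p : ℕ → ℝ) (q : ℝ) : ℝ :=
  Real.logb c (∑ i ∈ Finset.range c, p i ^ q)

/-- `τ_{μ,n}(q)`, defined by `∑_{z ∈ 𝒜₁,₂ⁿ} μ([z])^q = |w|^{-τ_{μ,n}(q)}`. -/
def tauN (c₁ c₂ : ℕ) (T : ℕ → ℕ) (a b : ℕ → ℝ) (q : ℝ) (n : ℕ) : ℝ :=
  Real.log (∑ z : Word c₁ c₂ T n, cylWeight c₁ c₂ T a b n z ^ q) /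
    Real.log ((c₁ : ℝ) ^ Ncount T n * (c₂ : ℝ) ^ (n - Ncount T n))

/-- The natural projection `γ : ∂𝒜₁,₂* → [0,1]`,
`γ(ε₁ε₂⋯) = ∑_{n≥1} εₙ c₁^{-N_n} c₂^{-(n-N_n)}`. -/
def gammaMap (c₁ c₂ : ℕ) (T : ℕ → ℕ) (x : Omg c₁ c₂ T) : ℝ :=
  ∑' n : ℕ, ((x n).val : ℝ) * Dw c₁ c₂ T (n + 1)

/-- The normalized weights `pᵢ^q / (p₁^q + ⋯ + p_c^q)`. -/
def taW (c : ℕ) (p : ℕ → ℝ) (q : ℝ) (i : ℕ) : ℝ :=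
  p i ^ q / ∑ j ∈ Finset.range c, p j ^ q

/-- `s₁ = min{max aᵢ, max bⱼ}`. -/
def sOne (c₁ c₂ : ℕ) (a b : ℕ → ℝ) : ℝ :=
  min (sSup {x | ∃ i < c₁, a i = x}) (sSup {x | ∃ j < c₂, b j = x})

/-- `s₂ = max{min aᵢ, min bⱼ}`. -/
def sTwo (c₁ c₂ : ℕ) (a b : ℕ → ℝ) : ℝ :=
  max (sInf {x | ∃ i < c₁, a i = x}) (sInf {x | ∃ j < c₂, b j = x})

/-- Entropy `h(p) = -∑_{i<2} pᵢ log₂ pᵢ`. -/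
def hEnt (p : ℕ → ℝ) : ℝ := -(∑ i ∈ Finset.range 2, p i * Real.logb 2 (p i))

/-! ### Dyadic intervals -/

/-- The family `𝓕_n` of dyadic intervals of generation `n` in `[0,1]`. -/
def Fnfam (n : ℕ) : Set (Set ℝ) :=
  {I | ∃ j : ℕ, j < 2 ^ n ∧ I = Set.Icc ((j : ℝ) / 2 ^ n) (((j : ℝ) + 1) / 2 ^ n)}

/-- Index of the dyadic interval of generation `n` containing `x`
(the left one when `x` is dyadic). -/
def dyadIdx (n : ℕ) (x : ℝ) : ℤ := ⌈x * 2 ^ n⌉ - 1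

/-- `I_n(x)`: the dyadic interval of generation `n` containing `x`
(the left one when `x` is dyadic). -/
def Idyad (n : ℕ) (x : ℝ) : Set ℝ :=
  Set.Icc ((dyadIdx n x : ℝ) / 2 ^ n) (((dyadIdx n x : ℝ) + 1) / 2 ^ n)

/-- `I_n(x)⁺`: the right neighbour of `I_n(x)` in `𝓕_n`. -/
def IdyadP (n : ℕ) (x : ℝ) : Set ℝ :=
  Set.Icc (((dyadIdx n x : ℝ) + 1) / 2 ^ n) (((dyadIdx n x : ℝ) + 2) / 2 ^ n)

/-- `I_n(x)⁻`: the left neighbour of `I_n(x)` in `𝓕_n`. -/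
def IdyadM (n : ℕ) (x : ℝ) : Set ℝ :=
  Set.Icc (((dyadIdx n x : ℝ) - 1) / 2 ^ n) ((dyadIdx n x : ℝ) / 2 ^ n)

/-! ### Mixed-radix expansions -/

/-- The length `∏_{i<n} 1 / Y i` of the mixed-radix intervals of generation `n`. -/
def digitScale (Y : ℕ → ℕ) (n : ℕ) : ℝ := ∏ i ∈ Finset.range n, (Y i : ℝ)⁻¹

/-- The integer with mixed-radix digits `x 0, …, x (n - 1)`. -/
def digitIndex (Y : ℕ → ℕ) (x : ∀ n, Fin (Y n)) : ℕ → ℕ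
  | 0 => 0
  | n + 1 => digitIndex Y x n * Y n + (x n).val

/-- The point with mixed-radix digits `x`. -/
def digitPoint (Y : ℕ → ℕ) (x : ∀ n, Fin (Y n)) : ℝ :=
  ∑' n : ℕ, ((x n).val : ℝ) * digitScale Y (n + 1)

/-- The cylinder of generation `n` around `x`. -/
def digitCyl (Y : ℕ → ℕ) (x : ∀ n, Fin (Y n)) (n : ℕ) : Set (∀ n, Fin (Y n)) :=
  {z | ∀ i < n, z i = x i}

theorem digitScale_zero (Y : ℕ → ℕ) : digitScale Y 0 = 1 := by simp [digitScale]

theorem digitScale_succ (Y : ℕ → ℕ) (n : ℕ) :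
    digitScale Y (n + 1) = digitScale Y n * (Y n : ℝ)⁻¹ := by
  rw [digitScale, digitScale, Finset.prod_range_succ]

theorem digitScale_pos {Y : ℕ → ℕ} (hY : ∀ n, 2 ≤ Y n) (n : ℕ) : 0 < digitScale Y n := by
  refine Finset.prod_pos fun i _ => inv_pos.2 ?_
  have := hY i
  positivity

theorem digitScale_succ_mul {Y : ℕ → ℕ} (hY : ∀ n, 2 ≤ Y n) (n : ℕ) :
    digitScale Y (n + 1) * Y n = digitScale Y n := by
  have : (Y n : ℝ) ≠ 0 := by have := hY n; positivity
  rw [digitScale_succ, mul_assoc, inv_mul_cancel₀ this, mul_one]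

theorem digitScale_strictAnti {Y : ℕ → ℕ} (hY : ∀ n, 2 ≤ Y n) : StrictAnti (digitScale Y) := by
  refine strictAnti_nat_of_succ_lt fun n => ?_
  have h1 := digitScale_succ_mul hY n
  have h2 := digitScale_pos hY (n + 1)
  have h3 : (2 : ℝ) ≤ Y n := by exact_mod_cast hY n
  nlinarith

theorem digitScale_le_pow {Y : ℕ → ℕ} (hY : ∀ n, 2 ≤ Y n) (n : ℕ) :
    digitScale Y n ≤ (1 / 2) ^ n := by
  induction n with
  | zero => simp [digitScale]
  | succ n ih =>
    have h1 := digitScale_succ_mul hY n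
    have h2 := digitScale_pos hY (n + 1)
    have h3 : (2 : ℝ) ≤ Y n := by exact_mod_cast hY n
    rw [pow_succ]
    nlinarith

theorem tendsto_digitScale {Y : ℕ → ℕ} (hY : ∀ n, 2 ≤ Y n) :
    Tendsto (digitScale Y) atTop (𝓝 0) :=
  squeeze_zero (fun n => (digitScale_pos hY n).le) (digitScale_le_pow hY)
    (tendsto_pow_atTop_nhds_zero_of_lt_one (by norm_num) (by norm_num))

theorem digitIndex_mul_succ {Y : ℕ → ℕ} (hY : ∀ n, 2 ≤ Y n) (x : ∀ n, Fin (Y n)) (n : ℕ) :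
    (digitIndex Y x (n + 1) : ℝ) * digitScale Y (n + 1) =
      digitIndex Y x n * digitScale Y n + (x n).val * digitScale Y (n + 1) := by
  rw [← digitScale_succ_mul hY n]
  simp only [digitIndex]
  push_cast
  ring

theorem sum_range_digits {Y : ℕ → ℕ} (hY : ∀ n, 2 ≤ Y n) (x : ∀ n, Fin (Y n)) (n : ℕ) :
    ∑ i ∈ Finset.range n, ((x i).val : ℝ) * digitScale Y (i + 1) =
      digitIndex Y x n * digitScale Y n := by
  induction n with
  | zero => simp [digitIndex]
  | succ n ih => rw [Finset.sum_range_succ, ih, digitIndex_mul_succ hY]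

theorem monotone_digitIndex_mul {Y : ℕ → ℕ} (hY : ∀ n, 2 ≤ Y n) (x : ∀ n, Fin (Y n)) :
    Monotone fun n => (digitIndex Y x n : ℝ) * digitScale Y n := by
  refine monotone_nat_of_le_succ fun n => ?_
  rw [digitIndex_mul_succ hY]
  have := (digitScale_pos hY (n + 1)).le
  have : 0 ≤ ((x n).val : ℝ) * digitScale Y (n + 1) := by positivity
  linarith

theorem antitone_digitIndex_add_one_mul {Y : ℕ → ℕ} (hY : ∀ n, 2 ≤ Y n) (x : ∀ n, Fin (Y n)) :
    Antitone fun n => ((digitIndex Y x n : ℝ) + 1) * digitScale Y n := by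
  refine antitone_nat_of_succ_le fun n => ?_
  rw [add_mul, add_mul, digitIndex_mul_succ hY]
  have h1 := digitScale_succ_mul hY n
  have h2 := digitScale_pos hY (n + 1)
  have h3 : ((x n).val : ℝ) + 1 ≤ Y n := by exact_mod_cast (x n).isLt
  nlinarith

theorem sum_range_digits_le {Y : ℕ → ℕ} (hY : ∀ n, 2 ≤ Y n) (x : ∀ n, Fin (Y n)) (n m : ℕ) :
    ∑ i ∈ Finset.range m, ((x i).val : ℝ) * digitScale Y (i + 1) ≤
      ((digitIndex Y x n : ℝ) + 1) * digitScale Y n := by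
  rw [sum_range_digits hY]
  have h1 := monotone_digitIndex_mul hY x (le_max_right n m)
  have h2 := antitone_digitIndex_add_one_mul hY x (le_max_left n m)
  have h3 := digitScale_pos hY (max n m)
  simp only at h1 h2
  nlinarith

theorem summable_digits {Y : ℕ → ℕ} (hY : ∀ n, 2 ≤ Y n) (x : ∀ n, Fin (Y n)) :
    Summable fun n => ((x n).val : ℝ) * digitScale Y (n + 1) :=
  summable_of_sum_range_le (fun n => mul_nonneg (by positivity) (digitScale_pos hY _).le)
    (fun m => sum_range_digits_le hY x 0 m)

theorem digitIndex_mul_le_digitPoint {Y : ℕ → ℕ} (hY : ∀ n, 2 ≤ Y n) (x : ∀ n, Fin (Y n)) (n : ℕ) :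
    (digitIndex Y x n : ℝ) * digitScale Y n ≤ digitPoint Y x := by
  rw [← sum_range_digits hY]
  exact (summable_digits hY x).sum_le_tsum _
    (fun n _ => mul_nonneg (by positivity) (digitScale_pos hY _).le)

theorem digitPoint_le {Y : ℕ → ℕ} (hY : ∀ n, 2 ≤ Y n) (x : ∀ n, Fin (Y n)) (n : ℕ) :
    digitPoint Y x ≤ ((digitIndex Y x n : ℝ) + 1) * digitScale Y n :=
  Real.tsum_le_of_sum_range_le (fun n => mul_nonneg (by positivity) (digitScale_pos hY _).le)
    (fun m => sum_range_digits_le hY x n m)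

theorem digitIndex_congr {Y : ℕ → ℕ} {x z : ∀ n, Fin (Y n)} {n : ℕ} (h : ∀ i < n, z i = x i) :
    digitIndex Y z n = digitIndex Y x n := by
  induction n with
  | zero => rfl
  | succ n ih =>
    simp only [digitIndex]
    rw [ih fun i hi => h i (by omega), h n (by omega)]

theorem eq_of_digitIndex_eq {Y : ℕ → ℕ} {x z : ∀ n, Fin (Y n)} {n : ℕ}
    (h : digitIndex Y z n = digitIndex Y x n) : ∀ i < n, z i = x i := by
  induction n with
  | zero => intro i hi; omega
  | succ n ih =>
    simp only [digitIndex] at h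
    have hx := (x n).isLt
    have hz := (z n).isLt
    have hpos : 0 < Y n := by omega
    have h1 : digitIndex Y z n = digitIndex Y x n := by
      have := congrArg (· / Y n) h
      simpa [Nat.add_div_of_dvd_right, Nat.mul_add_div, Nat.div_eq_of_lt, hx, hz, hpos,
        mul_comm _ (Y n)] using this
    have h2 : (z n).val = (x n).val := by rw [h1] at h; omega
    intro i hi
    rcases Nat.lt_succ_iff_lt_or_eq.1 hi with hi | rfl
    · exact ih h1 i hi
    · exact Fin.ext h2

theorem mem_digitCyl_of_digitPoint_mem_Ioo {Y : ℕ → ℕ} (hY : ∀ n, 2 ≤ Y n)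
    {x z : ∀ n, Fin (Y n)} {n : ℕ}
    (h1 : (digitIndex Y x n : ℝ) * digitScale Y n < digitPoint Y z)
    (h2 : digitPoint Y z < ((digitIndex Y x n : ℝ) + 1) * digitScale Y n) :
    z ∈ digitCyl Y x n := by
  refine eq_of_digitIndex_eq ?_
  have h3 := digitIndex_mul_le_digitPoint hY z n
  have h4 := digitPoint_le hY z n
  have h5 := digitScale_pos hY n
  have h6 := lt_of_mul_lt_mul_right (h3.trans_lt h2) h5.le
  have h7 := lt_of_mul_lt_mul_right (h1.trans_le h4) h5.le
  have h6' : digitIndex Y z n < digitIndex Y x n + 1 := by exact_mod_cast h6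
  have h7' : digitIndex Y x n < digitIndex Y z n + 1 := by exact_mod_cast h7
  omega

/-- If between generations `n` and `m` the digits of `x` are neither all minimal nor all maximal,
then small balls around the point of `x` only meet the cylinder of generation `n`. -/
theorem preimage_closedBall_subset_digitCyl {Y : ℕ → ℕ} (hY : ∀ n, 2 ≤ Y n)
    {x : ∀ n, Fin (Y n)} {n m : ℕ} {r : ℝ} (hr : r < digitScale Y m)
    (hlo : ∃ i, n ≤ i ∧ i < m ∧ (x i).val ≠ 0) (hhi : ∃ i, n ≤ i ∧ i < m ∧ (x i).val + 1 ≠ Y i) :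
    digitPoint Y ⁻¹' closedBall (digitPoint Y x) r ⊆ digitCyl Y x n := by
  intro z hz
  rw [mem_preimage, mem_closedBall, Real.dist_eq, abs_le] at hz
  have anti := (digitScale_strictAnti hY).antitone
  refine mem_digitCyl_of_digitPoint_mem_Ioo hY ?_ ?_
  · obtain ⟨i, hni, him, hi⟩ := hlo
    have e1 := monotone_digitIndex_mul hY x hni
    have e2 := digitIndex_mul_le_digitPoint hY x (i + 1)
    rw [digitIndex_mul_succ hY] at e2
    have e3 : digitScale Y m ≤ digitScale Y (i + 1) := anti him
    have e4 : (1 : ℝ) ≤ (x i).val := by exact_mod_cast Nat.one_le_iff_ne_zero.2 hi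
    have e5 := digitScale_pos hY (i + 1)
    simp only at e1
    nlinarith
  · obtain ⟨i, hni, him, hi⟩ := hhi
    have e1 := antitone_digitIndex_add_one_mul hY x hni
    have e2 := digitPoint_le hY x (i + 1)
    rw [add_mul, digitIndex_mul_succ hY] at e2
    have e3 : digitScale Y m ≤ digitScale Y (i + 1) := anti him
    have e4 : ((x i).val : ℝ) + 2 ≤ Y i := by
      have := (x i).isLt
      exact_mod_cast (by omega : (x i).val + 2 ≤ Y i)
    have e5 := digitScale_pos hY (i + 1)
    have e6 := digitScale_succ_mul hY i
    simp only at e1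
    nlinarith

theorem digitCyl_subset_preimage_closedBall {Y : ℕ → ℕ} (hY : ∀ n, 2 ≤ Y n)
    (x : ∀ n, Fin (Y n)) (n : ℕ) {p s r : ℝ}
    (hp : |(digitIndex Y x n : ℝ) * digitScale Y n - p| ≤ s) (hr : s + digitScale Y n ≤ r) :
    digitCyl Y x n ⊆ digitPoint Y ⁻¹' closedBall p r := by
  intro z hz
  have h1 := digitIndex_mul_le_digitPoint hY z n
  have h2 := digitPoint_le hY z n
  rw [digitIndex_congr hz] at h1 h2
  have h3 := digitScale_pos hY n
  rw [mem_preimage, mem_closedBall, Real.dist_eq, abs_le]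
  rw [abs_le] at hp
  constructor <;> nlinarith

theorem digitCyl_subset_preimage_closedBall_self {Y : ℕ → ℕ} (hY : ∀ n, 2 ≤ Y n)
    (x : ∀ n, Fin (Y n)) (n : ℕ) :
    digitCyl Y x n ⊆ digitPoint Y ⁻¹' closedBall (digitPoint Y x) (digitScale Y n) := by
  intro z hz
  have h1 := digitIndex_mul_le_digitPoint hY z n
  have h2 := digitPoint_le hY z n
  have h1' := digitIndex_mul_le_digitPoint hY x n
  have h2' := digitPoint_le hY x n
  rw [digitIndex_congr hz] at h1 h2
  rw [mem_preimage, mem_closedBall, Real.dist_eq, abs_le]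
  constructor <;> nlinarith

theorem measurable_digitPoint {Y : ℕ → ℕ} (hY : ∀ n, 2 ≤ Y n) : Measurable (digitPoint Y) := by
  refine measurable_of_tendsto_metrizable
    (f := fun m x => ∑ i ∈ Finset.range m, ((x i).val : ℝ) * digitScale Y (i + 1))
    (fun m => ?_) (tendsto_pi_nhds.2 fun x => (summable_digits hY x).hasSum.tendsto_sum_nat)
  refine Finset.measurable_sum _ fun i _ => Measurable.mul_const ?_ _
  exact (measurable_of_finite fun j : Fin (Y i) => (j.val : ℝ)).comp (measurable_pi_apply i)

/-- Extension of a finite word by zeros. -/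
def wordExt {Y : ℕ → ℕ} (hY : ∀ n, 2 ≤ Y n) {n : ℕ} (w : ∀ i : Fin n, Fin (Y i.val)) :
    ∀ n, Fin (Y n) :=
  fun i => if h : i < n then w ⟨i, h⟩ else ⟨0, by have := hY i; omega⟩

theorem mem_digitCyl_wordExt {Y : ℕ → ℕ} (hY : ∀ n, 2 ≤ Y n) (x : ∀ n, Fin (Y n)) (n : ℕ) :
    x ∈ digitCyl Y (wordExt hY fun i : Fin n => x i) n := by
  intro i hi
  simp [wordExt, hi]

theorem wordExt_injective_digitIndex {Y : ℕ → ℕ} (hY : ∀ n, 2 ≤ Y n) (n : ℕ) :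
    Function.Injective fun w : ∀ i : Fin n, Fin (Y i.val) => digitIndex Y (wordExt hY w) n := by
  intro w z h
  funext i
  have := eq_of_digitIndex_eq h i i.isLt
  simpa [wordExt] using this

/-! ### Upper bound for the dimension of level sets -/

theorem rpow_le_iff_div_log_le {r g s : ℝ} (hr : 0 < r) (hr1 : r < 1) (hg : 0 < g) :
    r ^ s ≤ g ↔ Real.log g / Real.log r ≤ s := by
  rw [div_le_iff_of_neg (Real.log_neg hr hr1), ← Real.log_rpow hr,
    Real.log_le_log_iff (Real.rpow_pos_of_pos hr s) hg]

theorem le_rpow_iff_le_div_log {r g s : ℝ} (hr : 0 < r) (hr1 : r < 1) (hg : 0 < g) :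
    g ≤ r ^ s ↔ s ≤ Real.log g / Real.log r := by
  rw [le_div_iff_of_neg (Real.log_neg hr hr1), ← Real.log_rpow hr,
    Real.log_le_log_iff hg (Real.rpow_pos_of_pos hr s)]

theorem eventually_Ioo_zero_one : ∀ᶠ r : ℝ in 𝓝[>] 0, 0 < r ∧ r < 1 :=
  Ioo_mem_nhdsGT one_pos

theorem tendsto_log_div_log_iff {g : ℝ → ℝ} {α : ℝ} (hg : ∀ r, 0 < r → 0 < g r) :
    Tendsto (fun r => Real.log (g r) / Real.log r) (𝓝[>] 0) (𝓝 α) ↔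
      ∀ ε > 0, ∀ᶠ r in 𝓝[>] 0, r ^ (α + ε) ≤ g r ∧ g r ≤ r ^ (α - ε) := by
  constructor
  · intro h ε hε
    filter_upwards [h (Icc_mem_nhds (sub_lt_self α hε) (lt_add_of_pos_right α hε)),
      eventually_Ioo_zero_one] with r h1 ⟨h2, h3⟩
    rw [rpow_le_iff_div_log_le h2 h3 (hg r h2), le_rpow_iff_le_div_log h2 h3 (hg r h2)]
    exact ⟨h1.2, h1.1⟩
  · intro h
    rw [Metric.tendsto_nhds]
    intro ε hε
    filter_upwards [h (ε / 2) (by positivity), eventually_Ioo_zero_one] with r h1 ⟨h2, h3⟩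
    rw [rpow_le_iff_div_log_le h2 h3 (hg r h2), le_rpow_iff_le_div_log h2 h3 (hg r h2)] at h1
    rw [Real.dist_eq, abs_lt]
    constructor <;> linarith [h1.1, h1.2]

theorem exists_word_of_closedBall {Y : ℕ → ℕ} (hY : ∀ n, 2 ≤ Y n)
    (μ : Measure (∀ n, Fin (Y n))) (p : ℝ) (n : ℕ)
    (hpos : 0 < μ (digitPoint Y ⁻¹' closedBall p (digitScale Y n))) :
    ∃ w : ∀ i : Fin n, Fin (Y i.val),
      |(digitIndex Y (wordExt hY w) n : ℝ) * digitScale Y n - p| ≤ 2 * digitScale Y n ∧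
      μ (digitPoint Y ⁻¹' closedBall p (digitScale Y n)) ≤
        5 * μ (digitCyl Y (wordExt hY w) n) := by
  have hD := digitScale_pos hY n
  set D := digitScale Y n with hDdef
  set W : Finset (∀ i : Fin n, Fin (Y i.val)) := Finset.univ.filter fun w =>
    |(digitIndex Y (wordExt hY w) n : ℝ) * D - p| ≤ 2 * D with hW
  have hsub : digitPoint Y ⁻¹' closedBall p D ⊆ ⋃ w ∈ W, digitCyl Y (wordExt hY w) n := by
    intro z hz
    have hz' := mem_digitCyl_wordExt hY z n
    refine mem_iUnion₂.2 ⟨fun i => z i, ?_, hz'⟩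
    rw [hW, Finset.mem_filter]
    refine ⟨Finset.mem_univ _, ?_⟩
    rw [← digitIndex_congr hz']
    have h1 := digitIndex_mul_le_digitPoint hY z n
    have h2 := digitPoint_le hY z n
    rw [mem_preimage, mem_closedBall, Real.dist_eq, abs_le] at hz
    rw [abs_le]
    constructor <;> nlinarith
  have hle : μ (digitPoint Y ⁻¹' closedBall p D) ≤ ∑ w ∈ W, μ (digitCyl Y (wordExt hY w) n) :=
    (measure_mono hsub).trans (measure_biUnion_finset_le _ _)
  have hne : W.Nonempty := by
    rw [Finset.nonempty_iff_ne_empty]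
    intro h
    rw [h, Finset.sum_empty] at hle
    exact hpos.not_ge hle
  have hcard : W.card ≤ 5 := by
    have h1 : W.card ≤ (Finset.Icc ⌈p / D - 2⌉ ⌊p / D + 2⌋).card := by
      refine Finset.card_le_card_of_injOn
        (fun w => (digitIndex Y (wordExt hY w) n : ℤ)) (fun w hw => ?_) ?_
      · rw [hW, Finset.mem_coe, Finset.mem_filter, abs_le] at hw
        rw [Finset.mem_coe, Finset.mem_Icc, Int.ceil_le, Int.le_floor]
        have e : p / D * D = p := div_mul_cancel₀ p hD.ne'
        push_cast
        constructor
        · refine le_of_mul_le_mul_right ?_ hD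
          nlinarith [hw.2.1]
        · refine le_of_mul_le_mul_right ?_ hD
          nlinarith [hw.2.2]
      · intro w _ z _ h
        exact wordExt_injective_digitIndex hY n (by simpa using h)
    rw [Int.card_Icc] at h1
    have e1 : ⌊p / D + 2⌋ = ⌊p / D⌋ + 2 := by exact_mod_cast Int.floor_add_intCast (p / D) 2
    have e2 : ⌈p / D - 2⌉ = ⌈p / D⌉ - 2 := by exact_mod_cast Int.ceil_sub_intCast (p / D) 2
    have e3 := Int.floor_le_ceil (p / D)
    omega
  obtain ⟨w, hw, hmax⟩ := W.exists_max_image (fun w => μ (digitCyl Y (wordExt hY w) n)) hne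
  refine ⟨w, (Finset.mem_filter.1 hw).2, hle.trans ?_⟩
  calc ∑ z ∈ W, μ (digitCyl Y (wordExt hY z) n)
      ≤ W.card • μ (digitCyl Y (wordExt hY w) n) := Finset.sum_le_card_nsmul _ _ _ hmax
    _ = (W.card : ℝ≥0∞) * μ (digitCyl Y (wordExt hY w) n) := by rw [nsmul_eq_mul]
    _ ≤ 5 * μ (digitCyl Y (wordExt hY w) n) := by gcongr; exact_mod_cast hcard

/-- Mass of a finite word. -/
def wordMass {Y : ℕ → ℕ} (wt : ℕ → ℕ → ℝ) {n : ℕ} (w : ∀ i : Fin n, Fin (Y i.val)) : ℝ :=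
  ∏ i : Fin n, wt i (w i)

theorem prod_range_wordExt {Y : ℕ → ℕ} (hY : ∀ n, 2 ≤ Y n) (wt : ℕ → ℕ → ℝ) {n : ℕ}
    (w : ∀ i : Fin n, Fin (Y i.val)) :
    ∏ i ∈ Finset.range n, wt i (wordExt hY w i) = wordMass wt w := by
  rw [wordMass, ← Fin.prod_univ_eq_prod_range (fun i => wt i (wordExt hY w i))]
  refine Finset.prod_congr rfl fun i _ => ?_
  simp [wordExt]

theorem wordMass_pos {Y : ℕ → ℕ} {wt : ℕ → ℕ → ℝ} (hwt : ∀ i j, j < Y i → 0 < wt i j)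
    {n : ℕ} (w : ∀ i : Fin n, Fin (Y i.val)) : 0 < wordMass wt w :=
  Finset.prod_pos fun i _ => hwt _ _ (w i).isLt

theorem sum_wordMass_rpow {Y : ℕ → ℕ} {wt : ℕ → ℕ → ℝ} (hwt : ∀ i j, j < Y i → 0 < wt i j)
    (n : ℕ) (y : ℝ) :
    ∑ w : ∀ i : Fin n, Fin (Y i.val), wordMass wt w ^ y =
      ∏ i ∈ Finset.range n, ∑ j ∈ Finset.range (Y i), wt i j ^ y := by
  have h1 : ∀ w : ∀ i : Fin n, Fin (Y i.val),
      wordMass wt w ^ y = ∏ i : Fin n, wt i (w i) ^ y := fun w =>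
    (Real.finsetProd_rpow _ _ (fun i _ => (hwt _ _ (w i).isLt).le) y).symm
  simp_rw [h1]
  rw [← Fintype.prod_sum (fun (i : Fin n) (j : Fin (Y i)) => wt i j ^ y),
    ← Fin.prod_univ_eq_prod_range (fun i => ∑ j ∈ Finset.range (Y i), wt i j ^ y)]
  refine Finset.prod_congr rfl fun i _ => ?_
  rw [← Fin.sum_univ_eq_sum_range (fun j => wt i j ^ y)]

theorem measure_closedBall_pos_of_mem_msupport {m : Measure ℝ} {x : ℝ} (hx : x ∈ msupport m)
    {r : ℝ} (hr : 0 < r) : 0 < m (closedBall x r) :=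
  (hx r hr).trans_le (measure_mono ball_subset_closedBall)

theorem eventually_exists_word_of_mem_Xlev {Y : ℕ → ℕ} (hY : ∀ n, 2 ≤ Y n) {wt : ℕ → ℕ → ℝ}
    (hwt : ∀ i j, j < Y i → 0 < wt i j)
    (μ : Measure (∀ n, Fin (Y n))) [IsProbabilityMeasure μ]
    (hμ : ∀ x n, μ (digitCyl Y x n) = ENNReal.ofReal (∏ i ∈ Finset.range n, wt i (x i)))
    {α p : ℝ} (hp : p ∈ Xlev (μ.map (digitPoint Y)) α) {ε : ℝ} (hε : 0 < ε) :
    ∀ᶠ n in atTop, ∃ w : ∀ i : Fin n, Fin (Y i.val),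
      |(digitIndex Y (wordExt hY w) n : ℝ) * digitScale Y n - p| ≤ 2 * digitScale Y n ∧
      digitScale Y n ^ (α + ε) ≤ wordMass wt w ∧ wordMass wt w ≤ digitScale Y n ^ (α - ε) := by
  have hmeas := measurable_digitPoint hY
  have : IsProbabilityMeasure (μ.map (digitPoint Y)) :=
    Measure.isProbabilityMeasure_map hmeas.aemeasurable
  obtain ⟨hsupp, hlim⟩ := hp
  set ν := μ.map (digitPoint Y) with hν
  have happ : ∀ r, ν (closedBall p r) = μ (digitPoint Y ⁻¹' closedBall p r) := fun r =>
    Measure.map_apply hmeas measurableSet_closedBall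
  have hpos : ∀ r, 0 < r → 0 < (ν (closedBall p r)).toReal := fun r hr =>
    ENNReal.toReal_pos (measure_closedBall_pos_of_mem_msupport hsupp hr).ne' (measure_ne_top _ _)
  have key := (tendsto_log_div_log_iff hpos).1 hlim (ε / 2) (by positivity)
  have hDpos := digitScale_pos hY
  have hD0 := tendsto_digitScale hY
  have t1 : Tendsto (digitScale Y) atTop (𝓝[>] 0) :=
    tendsto_nhdsWithin_iff.2 ⟨hD0, Eventually.of_forall hDpos⟩
  have t3 : Tendsto (fun n => 3 * digitScale Y n) atTop (𝓝[>] 0) :=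
    tendsto_nhdsWithin_iff.2 ⟨by simpa using hD0.const_mul 3,
      Eventually.of_forall fun n => by simpa using hDpos n⟩
  have tε : Tendsto (fun n => digitScale Y n ^ (ε / 2)) atTop (𝓝 0) := by
    have := hD0.rpow_const (p := ε / 2) (Or.inr (by positivity))
    rwa [Real.zero_rpow (by positivity)] at this
  have c1 : ∀ᶠ n in atTop, digitScale Y n ^ (ε / 2) ≤ 1 / 5 :=
    tε.eventually (ge_mem_nhds (by norm_num))
  have c2 : ∀ᶠ n in atTop, (3 : ℝ) ^ (α - ε / 2) * digitScale Y n ^ (ε / 2) ≤ 1 := by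
    have := tε.const_mul ((3 : ℝ) ^ (α - ε / 2))
    rw [mul_zero] at this
    exact this.eventually (ge_mem_nhds one_pos)
  filter_upwards [t1.eventually key, t3.eventually key, c1, c2] with n k1 k3 c1 c2
  have hD := hDpos n
  obtain ⟨w, hw1, hw2⟩ := exists_word_of_closedBall hY μ p n
    (by rw [← happ]; exact measure_closedBall_pos_of_mem_msupport hsupp hD)
  have hcyl : μ (digitCyl Y (wordExt hY w) n) = ENNReal.ofReal (wordMass wt w) := by
    rw [hμ, prod_range_wordExt]
  have hM := wordMass_pos hwt w
  refine ⟨w, hw1, ?_, ?_⟩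
  · rw [← happ, hcyl] at hw2
    have h5 : (ν (closedBall p (digitScale Y n))).toReal ≤ 5 * wordMass wt w := by
      have := ENNReal.toReal_mono (by finiteness) hw2
      rwa [ENNReal.toReal_mul, ENNReal.toReal_ofReal hM.le, ENNReal.toReal_ofNat] at this
    have e : digitScale Y n ^ (α + ε) =
        digitScale Y n ^ (α + ε / 2) * digitScale Y n ^ (ε / 2) := by
      rw [← Real.rpow_add hD]; ring_nf
    have hq : 0 < digitScale Y n ^ (α + ε / 2) := Real.rpow_pos_of_pos hD _
    rw [e]
    nlinarith [k1.1]
  · have hsub := digitCyl_subset_preimage_closedBall hY (wordExt hY w) n hw1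
      (r := 3 * digitScale Y n) (by linarith)
    have h6 : wordMass wt w ≤ (ν (closedBall p (3 * digitScale Y n))).toReal := by
      have := ENNReal.toReal_mono (measure_ne_top _ _) (measure_mono (μ := μ) hsub)
      rwa [hcyl, ENNReal.toReal_ofReal hM.le, ← happ] at this
    refine h6.trans (k3.2.trans ?_)
    have e : digitScale Y n ^ (α - ε / 2) =
        digitScale Y n ^ (α - ε) * digitScale Y n ^ (ε / 2) := by
      rw [← Real.rpow_add hD]; ring_nf
    have hq : 0 < digitScale Y n ^ (α - ε) := Real.rpow_pos_of_pos hD _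
    rw [Real.mul_rpow (by norm_num) hD.le, e]
    nlinarith

theorem rpow_bound_of_mem {D M α ε y : ℝ} (hD : 0 < D) (hM : 0 < M) (h1 : D ^ (α + ε) ≤ M)
    (h2 : M ≤ D ^ (α - ε)) : D ^ (α * y + ε * |y|) ≤ M ^ y := by
  rcases le_or_gt 0 y with hy | hy
  · rw [abs_of_nonneg hy, ← add_mul, Real.rpow_mul hD.le]
    exact Real.rpow_le_rpow (Real.rpow_nonneg hD.le _) h1 hy
  · rw [abs_of_neg hy, show α * y + ε * -y = (α - ε) * y by ring, Real.rpow_mul hD.le]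
    exact Real.rpow_le_rpow_of_nonpos hM h2 hy.le

/-- If `∑ μ([w])^y ≤ |w|^{-(t+ε)}` along infinitely many generations, for every `ε > 0`, then the
level set of exponent `α` has dimension at most `α y + t`. -/
theorem dimH_Xlev_le {Y : ℕ → ℕ} (hY : ∀ n, 2 ≤ Y n) {wt : ℕ → ℕ → ℝ}
    (hwt : ∀ i j, j < Y i → 0 < wt i j)
    (μ : Measure (∀ n, Fin (Y n))) [IsProbabilityMeasure μ]
    (hμ : ∀ x n, μ (digitCyl Y x n) = ENNReal.ofReal (∏ i ∈ Finset.range n, wt i (x i)))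
    (α y t : ℝ)
    (ht : ∀ ε > 0, ∃ᶠ n in atTop, ∏ i ∈ Finset.range n, ∑ j ∈ Finset.range (Y i), wt i j ^ y ≤
      digitScale Y n ^ (-(t + ε))) :
    dimH (Xlev (μ.map (digitPoint Y)) α) ≤ ENNReal.ofReal (α * y + t) := by
  refine le_of_forall_gt_imp_ge_of_dense fun s hs => ?_
  rcases eq_or_ne s ∞ with rfl | hs_ne
  · exact le_top
  lift s to ℝ≥0 using hs_ne
  have hs0 : (0 : ℝ) < s := by
    have : (0 : ℝ≥0∞) < s := bot_le.trans_lt hs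
    exact_mod_cast this
  have hst : α * y + t < s := by
    by_contra! h
    have := ENNReal.ofReal_le_ofReal h
    rw [ENNReal.ofReal_coe_nnreal] at this
    exact hs.not_ge this
  obtain ⟨ε, hε, hεs⟩ : ∃ ε > 0, α * y + t + ε * (|y| + 1) ≤ s := by
    refine ⟨(s - (α * y + t)) / (|y| + 1), by have := abs_nonneg y; apply div_pos <;> linarith, ?_⟩
    rw [div_mul_cancel₀ _ (by positivity)]
    linarith
  have hDpos := digitScale_pos hY
  set G : ∀ n, Set (∀ i : Fin n, Fin (Y i.val)) := fun n =>
    {w | digitScale Y n ^ (α + ε) ≤ wordMass wt w ∧ wordMass wt w ≤ digitScale Y n ^ (α - ε)} with hG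
  set E : ℕ → Set ℝ := fun M => {p | ∀ n ≥ M, ∃ w ∈ G n,
    |(digitIndex Y (wordExt hY w) n : ℝ) * digitScale Y n - p| ≤ 2 * digitScale Y n} with hE
  have hsub : Xlev (μ.map (digitPoint Y)) α ⊆ ⋃ M, E M := by
    intro p hp
    obtain ⟨M, hM⟩ := eventually_atTop.1 (eventually_exists_word_of_mem_Xlev hY hwt μ hμ hp hε)
    refine mem_iUnion.2 ⟨M, fun n hn => ?_⟩
    obtain ⟨w, h1, h2⟩ := hM n hn
    exact ⟨w, h2, h1⟩
  refine (dimH_mono hsub).trans ?_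
  rw [dimH_iUnion]
  refine iSup_le fun M => dimH_le_of_hausdorffMeasure_ne_top (ne_top_of_le_ne_top
    (b := ENNReal.ofReal (4 ^ (s : ℝ))) ENNReal.ofReal_ne_top ?_)
  have hball : ∀ (c : ℝ) n, ediam (closedBall c (2 * digitScale Y n)) =
      ENNReal.ofReal (4 * digitScale Y n) := by
    intro c n
    rw [Real.closedBall_eq_Icc, Real.ediam_Icc]
    congr 1; ring
  refine (Measure.hausdorffMeasure_le_liminf_sum (ι := fun n => G n) (l := atTop) (s : ℝ) (E M)
    (fun n => ENNReal.ofReal (4 * digitScale Y n)) ?_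
    (fun n w => closedBall ((digitIndex Y (wordExt hY w.1) n : ℝ) * digitScale Y n)
      (2 * digitScale Y n)) ?_ ?_).trans ?_
  · rw [← ENNReal.ofReal_zero]
    exact ENNReal.tendsto_ofReal (by simpa using (tendsto_digitScale hY).const_mul 4)
  · exact Eventually.of_forall fun n w => (hball _ _).le
  · filter_upwards [eventually_ge_atTop M] with n hn p hp
    obtain ⟨w, hw, h⟩ := hp n hn
    refine mem_iUnion.2 ⟨⟨w, hw⟩, ?_⟩
    rwa [mem_closedBall, Real.dist_eq, abs_sub_comm]
  · refine liminf_le_of_frequently_le' ((ht ε hε).mono fun n hn => ?_)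
    simp_rw [hball]
    have hD := hDpos n
    rw [Finset.sum_const, nsmul_eq_mul, ENNReal.ofReal_rpow_of_pos (by positivity),
      ← ENNReal.ofReal_natCast, ← ENNReal.ofReal_mul (by positivity)]
    refine ENNReal.ofReal_le_ofReal ?_
    have hcount : (Finset.univ : Finset (G n)).card * digitScale Y n ^ (α * y + ε * |y|) ≤
        digitScale Y n ^ (-(t + ε)) := by
      refine le_trans ?_ hn
      rw [← sum_wordMass_rpow hwt, ← nsmul_eq_mul]
      calc (Finset.univ : Finset (G n)).card • digitScale Y n ^ (α * y + ε * |y|)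
          ≤ ∑ w : G n, wordMass wt w.1 ^ y := Finset.card_nsmul_le_sum _ _ _ fun w _ =>
            rpow_bound_of_mem hD (wordMass_pos hwt _) w.2.1 w.2.2
        _ = ∑ w ∈ (G n).toFinset, wordMass wt w ^ y :=
            Finset.sum_set_coe (f := fun w => wordMass wt w ^ y) (G n)
        _ ≤ _ := Finset.sum_le_sum_of_subset_of_nonneg (Finset.subset_univ _) fun w _ _ =>
            Real.rpow_nonneg (wordMass_pos hwt w).le _
    rw [Real.mul_rpow (by norm_num) hD.le]
    have e1 : digitScale Y n ^ (s : ℝ) = digitScale Y n ^ (α * y + ε * |y|) *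
        digitScale Y n ^ (s - (α * y + ε * |y|)) := by
      rw [← Real.rpow_add hD]; ring_nf
    have e2 : digitScale Y n ^ (-(t + ε)) * digitScale Y n ^ (s - (α * y + ε * |y|)) ≤ 1 := by
      rw [← Real.rpow_add hD]
      refine Real.rpow_le_one hD.le ?_ (by linarith)
      have := (digitScale_strictAnti hY).antitone (Nat.zero_le n)
      rwa [digitScale_zero] at this
    have e3 : 0 ≤ digitScale Y n ^ (s - (α * y + ε * |y|)) := Real.rpow_nonneg hD.le _
    calc (Finset.univ : Finset (G n)).card * (4 ^ (s : ℝ) * digitScale Y n ^ (s : ℝ))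
        = 4 ^ (s : ℝ) * (((Finset.univ : Finset (G n)).card *
          digitScale Y n ^ (α * y + ε * |y|)) *
          digitScale Y n ^ (s - (α * y + ε * |y|))) := by rw [e1]; ring
      _ ≤ 4 ^ (s : ℝ) * 1 := by
        refine mul_le_mul_of_nonneg_left ?_ (by positivity)
        exact (mul_le_mul_of_nonneg_right hcount e3).trans e2
      _ = 4 ^ (s : ℝ) := mul_one _

/-! ### Mass distribution and passage from cylinders to balls -/

theorem ofReal_le_dimH_of_ae {Ω : Type*} [MeasurableSpace Ω] (η : Measure Ω)
    [IsProbabilityMeasure η] {g : Ω → ℝ} (hg : Measurable g) (E : Set ℝ) {s : ℝ} (hs : 0 < s)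
    (h : ∀ᵐ ω ∂η, g ω ∈ E ∧
      ∀ᶠ r in 𝓝[>] 0, η (g ⁻¹' closedBall (g ω) r) ≤ ENNReal.ofReal (r ^ s)) :
    ENNReal.ofReal s ≤ dimH E := by
  set F : ℕ → Set Ω := fun M => {ω | g ω ∈ E ∧ ∀ r, 0 < r → r < 1 / ((M : ℝ) + 1) →
    η (g ⁻¹' closedBall (g ω) r) ≤ ENNReal.ofReal (r ^ s)} with hF
  obtain ⟨M, hM⟩ : ∃ M, η (F M) ≠ 0 := by
    by_contra! hzero
    have h0 : η (⋃ M, F M) = 0 := measure_iUnion_null hzero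
    have h1 : ∀ᵐ ω ∂η, ω ∈ ⋃ M, F M := by
      filter_upwards [h] with ω ⟨hω1, hω2⟩
      obtain ⟨u, hu, hsub⟩ := (mem_nhdsGT_iff_exists_Ioo_subset).1 hω2
      obtain ⟨M, hM⟩ := exists_nat_one_div_lt (mem_Ioi.1 hu)
      exact mem_iUnion.2 ⟨M, hω1, fun r hr hrM => hsub ⟨hr, hrM.trans hM⟩⟩
    have h2 : ∀ᵐ ω ∂η, False := by
      filter_upwards [h1, measure_eq_zero_iff_ae_notMem.1 h0] with ω a b using b a
    exact (NeZero.ne η) (ae_eq_bot.1 (eventually_false_iff_eq_bot.1 h2))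
  set κ := (η.restrict (F M)).map g with hκ
  have hMpos : 0 < 1 / ((M : ℝ) + 1) := by positivity
  have hle : κ ≤ μH[s] := by
    refine Measure.le_hausdorffMeasure s κ (ENNReal.ofReal (1 / ((M : ℝ) + 1) / 2)) (by simpa using hMpos)
      fun S hS => ?_
    have hSfin : ediam S ≠ ∞ := ne_top_of_le_ne_top ENNReal.ofReal_ne_top hS
    refine (measure_mono subset_closure).trans ?_
    rw [hκ, Measure.map_apply hg isClosed_closure.measurableSet,
      Measure.restrict_apply (hg isClosed_closure.measurableSet)]
    rcases (g ⁻¹' closure S ∩ F M).eq_empty_or_nonempty with he | ⟨ω, hωS, hωF⟩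
    · rw [he, measure_empty]; exact bot_le
    set d := (ediam S).toReal with hd
    have hdM : d < 1 / ((M : ℝ) + 1) := by
      have := ENNReal.toReal_mono ENNReal.ofReal_ne_top hS
      rw [ENNReal.toReal_ofReal (by positivity)] at this
      linarith
    have hsub : closure S ⊆ closedBall (g ω) d := by
      intro z hz
      rw [mem_closedBall, dist_edist]
      refine ENNReal.toReal_mono hSfin ?_
      rw [← Metric.ediam_closure]
      exact Metric.edist_le_ediam_of_mem hz hωS
    have hlim : Tendsto (fun r : ℝ => ENNReal.ofReal (r ^ s)) (𝓝[>] d) (𝓝 (ENNReal.ofReal (d ^ s))) :=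
      ENNReal.tendsto_ofReal (((Real.continuous_rpow_const hs.le).tendsto d).mono_left
        nhdsWithin_le_nhds)
    have hfin : ENNReal.ofReal (d ^ s) = ediam S ^ s := by
      rw [← ENNReal.ofReal_rpow_of_nonneg ENNReal.toReal_nonneg hs.le,
        ENNReal.ofReal_toReal hSfin]
    rw [← hfin]
    refine ge_of_tendsto hlim ?_
    filter_upwards [Ioo_mem_nhdsGT hdM] with r hr
    refine le_trans (measure_mono ?_) (hωF.2 r (ENNReal.toReal_nonneg.trans_lt hr.1) hr.2)
    exact inter_subset_left.trans (preimage_mono (hsub.trans (closedBall_subset_closedBall hr.1.le)))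
  have hpos : κ E ≠ 0 := by
    refine (lt_of_lt_of_le (pos_iff_ne_zero.2 hM) ?_).ne'
    calc η (F M) ≤ η (g ⁻¹' E ∩ F M) := measure_mono fun ω hω => ⟨hω.1, hω⟩
      _ ≤ η.restrict (F M) (g ⁻¹' E) := Measure.le_restrict_apply _ _
      _ ≤ κ E := Measure.le_map_apply hg.aemeasurable _
  have hne : μH[s] E ≠ 0 := (lt_of_lt_of_le (pos_iff_ne_zero.2 hpos) (hle E)).ne'
  have := le_dimH_of_hausdorffMeasure_ne_zero (d := s.toNNReal) (s := E)
    (by rwa [Real.coe_toNNReal _ hs.le])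
  exact this

theorem eventually_of_scales {Y : ℕ → ℕ} (hY : ∀ n, 2 ≤ Y n) {Q : ℝ → Prop}
    (h : ∀ᶠ m in atTop, ∀ r, digitScale Y (m + 1) ≤ r → r < digitScale Y m → Q r) :
    ∀ᶠ r in 𝓝[>] 0, Q r := by
  obtain ⟨M, hM⟩ := eventually_atTop.1 h
  filter_upwards [Ioo_mem_nhdsGT (digitScale_pos hY M)] with r hr
  have hex : ∃ j, digitScale Y j ≤ r :=
    ((tendsto_digitScale hY).eventually (ge_mem_nhds hr.1)).exists
  have hj := Nat.find_spec hex
  have hMj : M < Nat.find hex := by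
    by_contra! hle
    exact (hj.trans_lt hr.2).not_ge ((digitScale_strictAnti hY).antitone hle)
  obtain ⟨m, hm⟩ := Nat.exists_eq_add_of_lt (Nat.zero_lt_of_lt hMj)
  have hm' : Nat.find hex = m + 1 := by omega
  refine hM m (by omega) r (hm' ▸ hj) ?_
  exact not_le.1 (Nat.find_min hex (m := m) (by omega))

theorem neg_log_digitScale_succ {Y : ℕ → ℕ} (hY : ∀ n, 2 ≤ Y n) (n : ℕ) :
    -Real.log (digitScale Y (n + 1)) = -Real.log (digitScale Y n) + Real.log (Y n) := by
  have : (Y n : ℝ) ≠ 0 := by have := hY n; positivity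
  rw [digitScale_succ, Real.log_mul (digitScale_pos hY n).ne' (inv_ne_zero this), Real.log_inv]
  ring

theorem mul_log_two_le_neg_log_digitScale {Y : ℕ → ℕ} (hY : ∀ n, 2 ≤ Y n) (n : ℕ) :
    n * Real.log 2 ≤ -Real.log (digitScale Y n) := by
  have := Real.log_le_log (digitScale_pos hY n) (digitScale_le_pow hY n)
  rw [Real.log_pow, one_div, Real.log_inv] at this
  linarith

theorem neg_log_digitScale_add_le {Y : ℕ → ℕ} (hY : ∀ n, 2 ≤ Y n) {C : ℕ} (hC : ∀ n, Y n ≤ C)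
    (n j : ℕ) :
    -Real.log (digitScale Y (n + j)) ≤ -Real.log (digitScale Y n) + j * Real.log C := by
  induction j with
  | zero => simp
  | succ j ih =>
    rw [← add_assoc, neg_log_digitScale_succ hY]
    have h1 : Real.log (Y (n + j)) ≤ Real.log C := by
      refine Real.log_le_log ?_ (by exact_mod_cast hC _)
      have := hY (n + j)
      positivity
    push_cast
    linarith

theorem eventually_le_rpow_of_cylinders {Y : ℕ → ℕ} (hY : ∀ n, 2 ≤ Y n) {C : ℕ}
    (hC : ∀ n, Y n ≤ C) {β : ℝ} {u : ℕ → ℝ}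
    (hu : ∀ δ > 0, ∀ᶠ n : ℕ in atTop, β * -Real.log (digitScale Y n) - δ * n ≤ u n) {G : ℝ → ℝ}
    (hG : ∀ k : ℕ, ∀ᶠ m in atTop, ∀ r, digitScale Y (m + 1) ≤ r → r < digitScale Y m →
      G r ≤ Real.exp (-u (m - m / (k + 1)))) {δ : ℝ} (hδ : 0 < δ) :
    ∀ᶠ r in 𝓝[>] 0, G r ≤ r ^ (β - δ) := by
  have hl2 : 0 < Real.log 2 := Real.log_pos one_lt_two
  have hlC : 0 ≤ Real.log C := Real.log_natCast_nonneg C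
  set c := δ * Real.log 2 / 4 with hc
  have hcpos : 0 < c := by positivity
  obtain ⟨k, hk⟩ := exists_nat_gt (|β| * Real.log C / c)
  have hk' : |β| * Real.log C ≤ c * (k + 1) := by
    rw [div_lt_iff₀ hcpos] at hk
    nlinarith
  have hn : Tendsto (fun m : ℕ => m - m / (k + 2)) atTop atTop := by
    refine tendsto_atTop.2 fun N => ?_
    filter_upwards [eventually_ge_atTop (2 * N)] with m hm
    have : m / (k + 2) ≤ m / 2 := Nat.div_le_div_left (by omega) (by norm_num)
    omega
  have hlarge : ∀ᶠ m : ℕ in atTop, |β| * Real.log C ≤ c * m := by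
    have : Tendsto (fun m : ℕ => c * m) atTop atTop :=
      tendsto_natCast_atTop_atTop.const_mul_atTop hcpos
    exact this.eventually_ge_atTop _
  refine eventually_of_scales hY ?_
  filter_upwards [hG (k + 1), hn.eventually (hu (2 * c) (by positivity)), hlarge]
    with m h1 h2 h3 r hr1 hr2
  have hrpos : 0 < r := (digitScale_pos hY _).trans_le hr1
  refine (h1 r hr1 hr2).trans ?_
  rw [Real.rpow_def_of_pos hrpos, Real.exp_le_exp]
  set q := m / (k + 1 + 1) with hq
  set n := m - q with hnq
  have hqm : q ≤ m := Nat.div_le_self _ _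
  have hmn : m + 1 = n + (q + 1) := by omega
  have hnm : n ≤ m := Nat.sub_le _ _
  have a1 : -Real.log r ≤ -Real.log (digitScale Y (m + 1)) := by
    linarith [Real.log_le_log (digitScale_pos hY _) hr1]
  have a2 : -Real.log (digitScale Y m) ≤ -Real.log r := by
    linarith [Real.log_le_log hrpos hr2.le]
  have a3 := neg_log_digitScale_add_le hY hC n (q + 1)
  rw [← hmn] at a3
  have a4 : -Real.log (digitScale Y n) ≤ -Real.log (digitScale Y m) := by
    have := Real.log_le_log (digitScale_pos hY m) ((digitScale_strictAnti hY).antitone hnm)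
    linarith
  have a5 := mul_log_two_le_neg_log_digitScale hY m
  have a6 : (q : ℝ) * (k + 1) ≤ m := by
    have : q * (k + 1 + 1) ≤ m := Nat.div_mul_le_self _ _
    have h' : q * (k + 1) ≤ m := by nlinarith
    exact_mod_cast h'
  have a7 : |β * (-Real.log r - -Real.log (digitScale Y n))| ≤ |β| * ((q + 1) * Real.log C) := by
    rw [abs_mul]
    refine mul_le_mul_of_nonneg_left ?_ (abs_nonneg _)
    rw [abs_of_nonneg (by linarith)]
    push_cast at a3
    linarith
  have a8 := (abs_le.1 a7).2
  have a9 : |β| * ((q + 1) * Real.log C) ≤ 2 * (c * m) := by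
    have : |β| * Real.log C * q ≤ c * (k + 1) * q :=
      mul_le_mul_of_nonneg_right hk' (by positivity)
    nlinarith
  have a10 : (n : ℝ) ≤ m := by exact_mod_cast hnm
  have a11 : 4 * (c * m) ≤ δ * -Real.log r := by
    have : δ * (m * Real.log 2) ≤ δ * -Real.log r :=
      mul_le_mul_of_nonneg_left (a5.trans a2) hδ.le
    rw [hc]; linarith
  have a12 : 2 * c * n ≤ 2 * (c * m) := by nlinarith
  have e : β * (-Real.log r - -Real.log (digitScale Y n)) =
    β * -Real.log r - β * -Real.log (digitScale Y n) := by ring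
  rw [e] at a8
  nlinarith

theorem eventually_rpow_le_of_cylinders {Y : ℕ → ℕ} (hY : ∀ n, 2 ≤ Y n) {C : ℕ}
    (hC : ∀ n, Y n ≤ C) {β : ℝ} {u : ℕ → ℝ}
    (hu : ∀ δ > 0, ∀ᶠ n : ℕ in atTop, u n ≤ β * -Real.log (digitScale Y n) + δ * n) {G : ℝ → ℝ}
    (hG : ∀ m, ∀ r, digitScale Y (m + 1) ≤ r → Real.exp (-u (m + 1)) ≤ G r)
    {δ : ℝ} (hδ : 0 < δ) :
    ∀ᶠ r in 𝓝[>] 0, r ^ (β + δ) ≤ G r := by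
  have hl2 : 0 < Real.log 2 := Real.log_pos one_lt_two
  have hlC : 0 ≤ Real.log C := Real.log_natCast_nonneg C
  set c := δ * Real.log 2 / 2 with hc
  have hcpos : 0 < c := by positivity
  have hlarge : ∀ᶠ m : ℕ in atTop, |β| * Real.log C + c ≤ c * m := by
    have : Tendsto (fun m : ℕ => c * m) atTop atTop :=
      tendsto_natCast_atTop_atTop.const_mul_atTop hcpos
    exact this.eventually_ge_atTop _
  refine eventually_of_scales hY ?_
  filter_upwards [(tendsto_add_atTop_nat 1).eventually (hu c hcpos), hlarge]
    with m h2 h3 r hr1 hr2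
  have hrpos : 0 < r := (digitScale_pos hY _).trans_le hr1
  refine le_trans ?_ (hG m r hr1)
  rw [Real.rpow_def_of_pos hrpos, Real.exp_le_exp]
  have a1 : -Real.log r ≤ -Real.log (digitScale Y (m + 1)) := by
    linarith [Real.log_le_log (digitScale_pos hY _) hr1]
  have a2 : -Real.log (digitScale Y m) ≤ -Real.log r := by
    linarith [Real.log_le_log hrpos hr2.le]
  have a3 := neg_log_digitScale_add_le hY hC m 1
  have a5 := mul_log_two_le_neg_log_digitScale hY m
  have a7 : |β * (-Real.log (digitScale Y (m + 1)) - -Real.log r)| ≤ |β| * Real.log C := by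
    rw [abs_mul]
    refine mul_le_mul_of_nonneg_left ?_ (abs_nonneg _)
    rw [abs_of_nonneg (by linarith)]
    push_cast at a3
    linarith
  have a8 := (abs_le.1 a7).2
  have a11 : 2 * (c * m) ≤ δ * -Real.log r := by
    have : δ * (m * Real.log 2) ≤ δ * -Real.log r :=
      mul_le_mul_of_nonneg_left (a5.trans a2) hδ.le
    rw [hc]; linarith
  push_cast at h2
  nlinarith

/-! ### Product measures -/

theorem ae_eventually_sum_lt {X : ℕ → Type*} [∀ n, MeasurableSpace (X n)]
    (P : ∀ n, Measure (X n)) [∀ n, IsProbabilityMeasure (P n)] {f : ∀ n, X n → ℝ}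
    (hf : ∀ n, Measurable (f n)) {B : ℝ} (hB : ∀ n x, |f n x| ≤ B) {δ : ℝ} (hδ : 0 < δ) :
    ∀ᵐ ω ∂Measure.infinitePi P, ∀ᶠ n : ℕ in atTop,
      ∑ i ∈ Finset.range n, (f i (ω i) - ∫ x, f i x ∂P i) < δ * n := by
  set η := Measure.infinitePi P with hη
  set c : ℝ≥0 := (‖(|B| + 1) - (-(|B| + 1))‖₊ / 2) ^ 2 with hc
  have hcpos : 0 < c := by
    have h1 : (|B| + 1) - (-(|B| + 1)) ≠ 0 := by have := abs_nonneg B; linarith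
    have := nnnorm_pos.2 h1
    positivity
  have hint : ∀ i, ∫ ω, f i (ω i) ∂η = ∫ x, f i x ∂P i := by
    intro i
    have := integral_map (μ := η) (measurable_pi_apply i).aemeasurable
      (f := f i) (hf i).aestronglyMeasurable
    rw [← this]
    congr 1
    exact Measure.infinitePi_map_eval P i
  have hindep : ProbabilityTheory.iIndepFun
      (fun i (ω : ∀ n, X n) => f i (ω i) - ∫ x, f i x ∂P i) η :=
    ProbabilityTheory.iIndepFun_infinitePi (P := P) (X := fun i x => f i x - ∫ x, f i x ∂P i)
      fun i => (hf i).sub_const _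
  have hsub : ∀ i, ProbabilityTheory.HasSubgaussianMGF
      (fun ω : ∀ n, X n => f i (ω i) - ∫ x, f i x ∂P i) c η := by
    intro i
    have := ProbabilityTheory.hasSubgaussianMGF_of_mem_Icc (μ := η)
      (X := fun ω : ∀ n, X n => f i (ω i)) (a := -(|B| + 1)) (b := |B| + 1)
      ((hf i).comp (measurable_pi_apply i)).aemeasurable
      (Eventually.of_forall fun ω => by
        have h1 := abs_le.1 (hB i (ω i))
        have h2 := le_abs_self B
        constructor <;> linarith [h1.1, h1.2])
    rwa [hint] at this
  have hbound : ∀ n : ℕ, η {ω | δ * n ≤ ∑ i ∈ Finset.range n, (f i (ω i) - ∫ x, f i x ∂P i)} ≤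
      ENNReal.ofReal (Real.exp (-δ ^ 2 / (2 * c)) ^ n) := by
    intro n
    have h1 := ProbabilityTheory.HasSubgaussianMGF.measure_sum_range_ge_le_of_iIndepFun hindep
      (n := n) (fun i _ => hsub i) (ε := δ * n) (by positivity)
    rw [← ofReal_measureReal]
    refine ENNReal.ofReal_le_ofReal (h1.trans (le_of_eq ?_))
    rw [← Real.exp_nat_mul]
    congr 1
    rcases Nat.eq_zero_or_pos n with rfl | hn
    · simp
    · have : (c : ℝ) ≠ 0 := by exact_mod_cast hcpos.ne'
      field_simp
  have hsum : ∑' n : ℕ, η {ω | δ * n ≤ ∑ i ∈ Finset.range n, (f i (ω i) - ∫ x, f i x ∂P i)} ≠ ∞ := by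
    refine ne_top_of_le_ne_top ?_ (ENNReal.tsum_le_tsum hbound)
    have : Real.exp (-δ ^ 2 / (2 * c)) < 1 := by
      rw [Real.exp_lt_one_iff]
      have : (0 : ℝ) < c := by exact_mod_cast hcpos
      rw [neg_div, neg_lt_zero]
      positivity
    exact (summable_geometric_of_lt_one (Real.exp_nonneg _) this).tsum_ofReal_ne_top
  filter_upwards [ae_eventually_notMem hsum] with ω hω
  filter_upwards [hω] with n hn
  simpa using hn

theorem ae_forall_eventually_abs_sum_le {X : ℕ → Type*} [∀ n, MeasurableSpace (X n)]
    (P : ∀ n, Measure (X n)) [∀ n, IsProbabilityMeasure (P n)] {f : ∀ n, X n → ℝ}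
    (hf : ∀ n, Measurable (f n)) {B : ℝ} (hB : ∀ n x, |f n x| ≤ B) :
    ∀ᵐ ω ∂Measure.infinitePi P, ∀ δ > 0, ∀ᶠ n : ℕ in atTop,
      |∑ i ∈ Finset.range n, f i (ω i) - ∑ i ∈ Finset.range n, ∫ x, f i x ∂P i| ≤ δ * n := by
  have h1 : ∀ᵐ ω ∂Measure.infinitePi P, ∀ k : ℕ, ∀ᶠ n : ℕ in atTop,
      ∑ i ∈ Finset.range n, (f i (ω i) - ∫ x, f i x ∂P i) < 1 / ((k : ℝ) + 1) * n :=
    ae_all_iff.2 fun k => ae_eventually_sum_lt P hf hB (by positivity)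
  have h2 : ∀ᵐ ω ∂Measure.infinitePi P, ∀ k : ℕ, ∀ᶠ n : ℕ in atTop,
      ∑ i ∈ Finset.range n, (-f i (ω i) - ∫ x, -f i x ∂P i) < 1 / ((k : ℝ) + 1) * n :=
    ae_all_iff.2 fun k => ae_eventually_sum_lt P (f := fun n x => -f n x) (fun n => (hf n).neg)
      (fun n x => by rw [abs_neg]; exact hB n x) (by positivity)
  filter_upwards [h1, h2] with ω h1 h2 δ hδ
  obtain ⟨k, hk⟩ := exists_nat_one_div_lt hδ
  filter_upwards [h1 k, h2 k] with n h1 h2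
  have h3 : 1 / ((k : ℝ) + 1) * n ≤ δ * n := mul_le_mul_of_nonneg_right hk.le (by positivity)
  simp only [integral_neg, Finset.sum_sub_distrib, Finset.sum_neg_distrib] at h1 h2
  rw [abs_le]
  constructor <;> linarith

theorem summable_pow_div {ρ : ℝ} (h0 : 0 < ρ) (h1 : ρ < 1) (k : ℕ) :
    Summable fun m : ℕ => ρ ^ (m / (k + 1)) := by
  set q := ρ ^ (1 / ((k : ℝ) + 1)) with hq
  have hq0 : 0 ≤ q := Real.rpow_nonneg h0.le _
  have hq1 : q < 1 := Real.rpow_lt_one h0.le h1 (by positivity)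
  refine Summable.of_nonneg_of_le (fun m => by positivity) (fun m => ?_)
    ((summable_geometric_of_lt_one hq0 hq1).mul_left ρ⁻¹)
  rw [inv_mul_eq_div, le_div_iff₀ h0, ← pow_succ, hq, ← Real.rpow_natCast, ← Real.rpow_natCast,
    ← Real.rpow_mul h0.le]
  refine Real.rpow_le_rpow_of_exponent_ge h0 h1.le ?_
  have : m < (m / (k + 1) + 1) * (k + 1) := by
    have := Nat.lt_div_mul_add (a := m) (Nat.succ_pos k)
    rw [Nat.succ_eq_add_one] at this
    linarith
  rw [one_div_mul_eq_div, div_le_iff₀ (by positivity)]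
  exact_mod_cast this.le

theorem ae_forall_eventually_exists_notMem {X : ℕ → Type*} [∀ n, MeasurableSpace (X n)]
    (P : ∀ n, Measure (X n)) [∀ n, IsProbabilityMeasure (P n)] {A : ∀ n, Set (X n)}
    (hA : ∀ n, MeasurableSet (A n)) {ρ : ℝ} (h0 : 0 < ρ) (h1 : ρ < 1)
    (hρ : ∀ n, P n (A n) ≤ ENNReal.ofReal ρ) :
    ∀ᵐ ω ∂Measure.infinitePi P, ∀ k : ℕ, ∀ᶠ m in atTop,
      ∃ i, m - m / (k + 1) ≤ i ∧ i < m ∧ ω i ∉ A i := by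
  refine ae_all_iff.2 fun k => ?_
  have hbound : ∀ m : ℕ, Measure.infinitePi P
      (Set.pi (Finset.Ico (m - m / (k + 1)) m : Finset ℕ) A) ≤
      ENNReal.ofReal (ρ ^ (m / (k + 1))) := by
    intro m
    rw [Measure.infinitePi_pi _ fun i _ => hA i]
    refine (Finset.prod_le_pow_card _ _ _ fun i _ => hρ i).trans (le_of_eq ?_)
    rw [Nat.card_Ico, Nat.sub_sub_self (Nat.div_le_self _ _), ENNReal.ofReal_pow h0.le]
  have hsum : ∑' m : ℕ, Measure.infinitePi P
      (Set.pi (Finset.Ico (m - m / (k + 1)) m : Finset ℕ) A) ≠ ∞ :=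
    ne_top_of_le_ne_top (summable_pow_div h0 h1 k).tsum_ofReal_ne_top
      (ENNReal.tsum_le_tsum hbound)
  filter_upwards [ae_eventually_notMem hsum] with ω hω
  filter_upwards [hω] with m hm
  simp only [Set.mem_pi, Finset.mem_coe, Finset.mem_Ico, not_forall] at hm
  obtain ⟨i, ⟨hi1, hi2⟩, hi3⟩ := hm
  exact ⟨i, hi1, hi2, hi3⟩

/-- The measure on `Fin c` with weights `p`. -/
def finMeasure (c : ℕ) (p : ℕ → ℝ) : Measure (Fin c) :=
  ∑ j : Fin c, ENNReal.ofReal (p j) • Measure.dirac j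

theorem finMeasure_singleton (c : ℕ) (p : ℕ → ℝ) (j : Fin c) :
    finMeasure c p {j} = ENNReal.ofReal (p j) := by
  rw [finMeasure, Measure.finsetSum_apply, Finset.sum_eq_single j]
  · simp
  · intro i _ hi
    simp [hi]
  · simp

theorem isProbabilityMeasure_finMeasure {c : ℕ} {p : ℕ → ℝ} (hp : ∀ j < c, 0 ≤ p j)
    (hsum : ∑ j ∈ Finset.range c, p j = 1) : IsProbabilityMeasure (finMeasure c p) := by
  constructor
  simp only [finMeasure, Measure.finsetSum_apply, Measure.smul_apply, measure_univ, smul_eq_mul,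
    mul_one]
  rw [← ENNReal.ofReal_sum_of_nonneg fun (j : Fin c) _ => hp j j.isLt,
    Fin.sum_univ_eq_sum_range (fun j => p j), hsum, ENNReal.ofReal_one]

theorem integral_finMeasure {c : ℕ} {p : ℕ → ℝ} (hp : ∀ j < c, 0 ≤ p j)
    (hsum : ∑ j ∈ Finset.range c, p j = 1) (f : ℕ → ℝ) :
    ∫ j, f j ∂finMeasure c p = ∑ j ∈ Finset.range c, p j * f j := by
  have := isProbabilityMeasure_finMeasure hp hsum
  rw [integral_fintype Integrable.of_finite, ← Fin.sum_univ_eq_sum_range (fun j => p j * f j)]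
  refine Finset.sum_congr rfl fun j _ => ?_
  rw [Measure.real, finMeasure_singleton, ENNReal.toReal_ofReal (hp j j.isLt), smul_eq_mul]

theorem infinitePi_finMeasure_digitCyl {Y : ℕ → ℕ} {p : ℕ → ℕ → ℝ}
    (hp : ∀ n, ∀ j < Y n, 0 ≤ p n j) (hsum : ∀ n, ∑ j ∈ Finset.range (Y n), p n j = 1)
    (x : ∀ n, Fin (Y n)) (n : ℕ) :
    Measure.infinitePi (fun n => finMeasure (Y n) (p n)) (digitCyl Y x n) =
      ENNReal.ofReal (∏ i ∈ Finset.range n, p i (x i)) := by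
  have := fun n => isProbabilityMeasure_finMeasure (hp n) (hsum n)
  have : digitCyl Y x n = Set.pi (Finset.range n : Finset ℕ) fun i => {x i} := by
    ext z
    simp [digitCyl]
  rw [this, Measure.infinitePi_pi _ fun i _ => measurableSet_singleton _,
    ENNReal.ofReal_prod_of_nonneg fun i _ => hp i _ (x i).isLt]
  exact Finset.prod_congr rfl fun i _ => finMeasure_singleton _ _ _

theorem neg_log_digitScale_eq_sum {Y : ℕ → ℕ} (hY : ∀ n, 2 ≤ Y n) (n : ℕ) :
    -Real.log (digitScale Y n) = ∑ i ∈ Finset.range n, Real.log (Y i) := by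
  rw [digitScale, Real.log_prod fun i _ =>
    inv_ne_zero (Nat.cast_ne_zero.2 (Nat.ne_of_gt (zero_lt_two.trans_le (hY i)))),
    ← Finset.sum_neg_distrib]
  simp

theorem finMeasure_le_of_subsingleton {c : ℕ} {p : ℕ → ℝ} {ρ : ℝ} (hρ : ∀ j < c, p j ≤ ρ)
    {A : Set (Fin c)} (hA : A.Subsingleton) : finMeasure c p A ≤ ENNReal.ofReal ρ := by
  rcases hA.eq_empty_or_singleton with rfl | ⟨j, rfl⟩
  · simp
  · rw [finMeasure_singleton]
    exact ENNReal.ofReal_le_ofReal (hρ j j.isLt)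

theorem ofReal_le_dimH_Xlev {Y : ℕ → ℕ} (hY : ∀ n, 2 ≤ Y n) {C : ℕ} (hC : ∀ n, Y n ≤ C)
    {wt p : ℕ → ℕ → ℝ} {B ρ α L : ℝ} (hwt : ∀ n, ∀ j < Y n, 0 < wt n j)
    (hwtB : ∀ n, ∀ j < Y n, |Real.log (wt n j)| ≤ B)
    (hp : ∀ n, ∀ j < Y n, 0 ≤ p n j) (hsum : ∀ n, ∑ j ∈ Finset.range (Y n), p n j = 1)
    (hpB : ∀ n, ∀ j < Y n, |Real.log (p n j)| ≤ B)
    (hρ0 : 0 < ρ) (hρ1 : ρ < 1) (hρ : ∀ n, ∀ j < Y n, p n j ≤ ρ)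
    (μ : Measure (∀ n, Fin (Y n))) [IsProbabilityMeasure μ]
    (hμ : ∀ x n, μ (digitCyl Y x n) = ENNReal.ofReal (∏ i ∈ Finset.range n, wt i (x i)))
    (hα : ∀ n, ∑ j ∈ Finset.range (Y n), p n j * -Real.log (wt n j) = α * Real.log (Y n))
    (hL : ∀ n, L * Real.log (Y n) ≤ ∑ j ∈ Finset.range (Y n), p n j * -Real.log (p n j)) :
    ENNReal.ofReal L ≤ dimH (Xlev (μ.map (digitPoint Y)) α) := by
  have hP := fun n => isProbabilityMeasure_finMeasure (hp n) (hsum n)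
  set P := fun n => finMeasure (Y n) (p n) with hPdef
  have hmu_pos : ∀ x n, 0 < μ (digitCyl Y x n) := fun x n => by
    rw [hμ, ENNReal.ofReal_pos]
    exact Finset.prod_pos fun i _ => hwt i _ (x i).isLt
  have hmu_eq : ∀ x n, (μ (digitCyl Y x n)).toReal =
      Real.exp (-∑ i ∈ Finset.range n, -Real.log (wt i (x i))) := fun x n => by
    rw [hμ, ENNReal.toReal_ofReal (Finset.prod_nonneg fun i _ => (hwt i _ (x i).isLt).le),
      Finset.sum_neg_distrib, neg_neg, Real.exp_sum]
    exact Finset.prod_congr rfl fun i _ => (Real.exp_log (hwt i _ (x i).isLt)).symm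
  have hη_le : ∀ x n, (Measure.infinitePi P (digitCyl Y x n)).toReal ≤
      Real.exp (-∑ i ∈ Finset.range n, -Real.log (p i (x i))) := fun x n => by
    rw [infinitePi_finMeasure_digitCyl hp hsum,
      ENNReal.toReal_ofReal (Finset.prod_nonneg fun i _ => hp i _ (x i).isLt),
      Finset.sum_neg_distrib, neg_neg, Real.exp_sum]
    exact Finset.prod_le_prod (fun i _ => hp i _ (x i).isLt) fun i _ => Real.le_exp_log _
  have hball : ∀ x r, μ.map (digitPoint Y) (closedBall (digitPoint Y x) r) =
      μ (digitPoint Y ⁻¹' closedBall (digitPoint Y x) r) := fun x r =>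
    Measure.map_apply (measurable_digitPoint hY) isClosed_closedBall.measurableSet
  have key : ∀ s, 0 < s → s < L →
      ENNReal.ofReal s ≤ dimH (Xlev (μ.map (digitPoint Y)) α) := by
    intro s hs hsL
    refine ofReal_le_dimH_of_ae (Measure.infinitePi P) (measurable_digitPoint hY) _ hs ?_
    filter_upwards [
      ae_forall_eventually_abs_sum_le P (f := fun n (j : Fin (Y n)) => -Real.log (wt n j)) (B := B)
        (fun n => measurable_of_finite _) (fun n j => by rw [abs_neg]; exact hwtB n j j.isLt),
      ae_forall_eventually_abs_sum_le P (f := fun n (j : Fin (Y n)) => -Real.log (p n j)) (B := B)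
        (fun n => measurable_of_finite _) (fun n j => by rw [abs_neg]; exact hpB n j j.isLt),
      ae_forall_eventually_exists_notMem P (A := fun n => {j : Fin (Y n) | j.val = 0})
        (fun n => (Set.toFinite _).measurableSet) hρ0 hρ1 (fun n =>
          finMeasure_le_of_subsingleton (hρ n) fun i hi j hj => Fin.ext (hi.trans hj.symm)),
      ae_forall_eventually_exists_notMem P (A := fun n => {j : Fin (Y n) | j.val + 1 = Y n})
        (fun n => (Set.toFinite _).measurableSet) hρ0 hρ1 (fun n =>
          finMeasure_le_of_subsingleton (hρ n) fun i hi j hj =>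
            Fin.ext (Nat.succ_injective (hi.trans hj.symm)))]
      with x hx1 hx2 hx3 hx4
    have hi1 : ∀ n, ∑ i ∈ Finset.range n, ∫ j : Fin (Y i), -Real.log (wt i j) ∂P i =
        α * -Real.log (digitScale Y n) := fun n => by
      rw [neg_log_digitScale_eq_sum hY, Finset.mul_sum]
      exact Finset.sum_congr rfl fun i _ =>
        (integral_finMeasure (hp i) (hsum i) fun j => -Real.log (wt i j)).trans (hα i)
    have hi2 : ∀ n, L * -Real.log (digitScale Y n) ≤
        ∑ i ∈ Finset.range n, ∫ j : Fin (Y i), -Real.log (p i j) ∂P i := fun n => by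
      rw [neg_log_digitScale_eq_sum hY, Finset.mul_sum]
      exact Finset.sum_le_sum fun i _ => (hL i).trans_eq
        (integral_finMeasure (hp i) (hsum i) fun j => -Real.log (p i j)).symm
    have hsub : ∀ k : ℕ, ∀ᶠ m in atTop, ∀ r, r < digitScale Y m →
        digitPoint Y ⁻¹' closedBall (digitPoint Y x) r ⊆ digitCyl Y x (m - m / (k + 1)) := by
      intro k
      filter_upwards [hx3 k, hx4 k] with m h3 h4 r hr
      exact preimage_closedBall_subset_digitCyl hY hr h3 h4
    have hpos : ∀ r, 0 < r → 0 < μ (digitPoint Y ⁻¹' closedBall (digitPoint Y x) r) := by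
      intro r hr
      obtain ⟨n, hn⟩ := ((tendsto_digitScale hY).eventually_lt_const hr).exists
      refine (hmu_pos x n).trans_le (measure_mono ?_)
      exact (digitCyl_subset_preimage_closedBall_self hY x n).trans
        (preimage_mono (closedBall_subset_closedBall hn.le))
    refine ⟨⟨fun r hr => ?_, ?_⟩, ?_⟩
    · refine ((hpos (r / 2) (by positivity)).trans_eq (hball x _).symm).trans_le
        (measure_mono (closedBall_subset_ball (by linarith)))
    · simp only [hball]
      refine (tendsto_log_div_log_iff fun r hr =>
        ENNReal.toReal_pos (hpos r hr).ne' (measure_ne_top _ _)).2 fun ε hε => ?_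
      refine (eventually_rpow_le_of_cylinders hY hC (β := α)
        (u := fun n => ∑ i ∈ Finset.range n, -Real.log (wt i (x i))) ?_ ?_ hε).and
        (eventually_le_rpow_of_cylinders hY hC (β := α)
        (u := fun n => ∑ i ∈ Finset.range n, -Real.log (wt i (x i))) ?_ ?_ hε)
      · intro δ hδ
        filter_upwards [hx1 δ hδ] with n hn
        rw [hi1] at hn
        linarith [(abs_le.1 hn).2]
      · intro m r hr
        rw [← hmu_eq]
        exact ENNReal.toReal_mono (measure_ne_top _ _) (measure_mono
          ((digitCyl_subset_preimage_closedBall_self hY x _).trans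
            (preimage_mono (closedBall_subset_closedBall hr))))
      · intro δ hδ
        filter_upwards [hx1 δ hδ] with n hn
        rw [hi1] at hn
        linarith [(abs_le.1 hn).1]
      · intro k
        filter_upwards [hsub k] with m hm r _ hr
        rw [← hmu_eq]
        exact ENNReal.toReal_mono (measure_ne_top _ _) (measure_mono (hm r hr))
    · have := eventually_le_rpow_of_cylinders hY hC (β := L)
        (u := fun n => ∑ i ∈ Finset.range n, -Real.log (p i (x i)))
        (G := fun r => (Measure.infinitePi P
          (digitPoint Y ⁻¹' closedBall (digitPoint Y x) r)).toReal) (δ := L - s) ?_ ?_ (by linarith)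
      · filter_upwards [this, self_mem_nhdsWithin] with r hr hr0
        rw [← ENNReal.ofReal_toReal (measure_ne_top (Measure.infinitePi P) _)]
        exact ENNReal.ofReal_le_ofReal (by simpa using hr)
      · intro δ hδ
        filter_upwards [hx2 δ hδ] with n hn
        linarith [(abs_le.1 hn).1, hi2 n]
      · intro k
        filter_upwards [hsub k] with m hm r _ hr
        exact (ENNReal.toReal_mono (measure_ne_top _ _) (measure_mono (hm r hr))).trans (hη_le _ _)
  rcases le_or_gt L 0 with hL0 | hL0
  · simp [ENNReal.ofReal_of_nonpos hL0]
  · refine le_of_tendsto (f := fun s => ENNReal.ofReal s) (x := 𝓝[<] L)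
      ((ENNReal.continuous_ofReal.tendsto L).mono_left nhdsWithin_le_nhds) ?_
    filter_upwards [Ioo_mem_nhdsLT hL0] with s hs
    exact key s hs.1 hs.2

theorem exists_gibbs_vector {ι : Type*} [Fintype ι] [Nonempty ι] {a : ι → ℝ} (ha : ∀ i, 0 < a i)
    {β m : ℝ} (hm : ∀ q : ℝ, m ≤ β * q + Real.log (∑ i, a i ^ q)) {ε : ℝ} (hε : 0 < ε) :
    ∃ P ∈ stdSimplex ℝ ι, m ≤ ∑ i, Real.negMulLog (P i) ∧
      (∑ i, P i * -Real.log (a i) - β) ^ 2 ≤ 4 * (Real.log (Fintype.card ι) - m) * ε := by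
  set S : ℝ → ℝ := fun q => ∑ i, a i ^ q with hS
  have hSpos : ∀ q, 0 < S q := fun q =>
    Finset.sum_pos (fun i _ => Real.rpow_pos_of_pos (ha i) q) Finset.univ_nonempty
  have hSd : ∀ q, HasDerivAt S (∑ i, a i ^ q * Real.log (a i)) q := fun q =>
    HasDerivAt.fun_sum fun i _ => by
      simpa [mul_comm] using Real.hasStrictDerivAt_const_rpow (ha i) q |>.hasDerivAt
  set g : ℝ → ℝ := fun q => β * q + Real.log (S q) + ε * q ^ 2 with hg
  have hgd : ∀ q, HasDerivAt g (β + (∑ i, a i ^ q * Real.log (a i)) / S q + ε * (2 * q)) q := by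
    intro q
    have h1 : HasDerivAt (fun q : ℝ => β * q) β q := by simpa using (hasDerivAt_id q).const_mul β
    have h2 : HasDerivAt (fun q : ℝ => ε * q ^ 2) (ε * (2 * q)) q := by
      simpa using (hasDerivAt_pow 2 q).const_mul ε
    exact (h1.add ((hSd q).log (hSpos q).ne')).add h2
  have hcoer : Tendsto g (cocompact ℝ) atTop := by
    refine tendsto_atTop_mono (fun q => add_le_add_left (hm q) (ε * q ^ 2)) ?_
    refine tendsto_atTop_add_const_left _ _ (Tendsto.const_mul_atTop hε ?_)
    have := (tendsto_pow_atTop (α := ℝ) two_ne_zero).comp (tendsto_norm_cocompact_atTop (E := ℝ))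
    simpa [Function.comp_def] using this
  obtain ⟨q, hq⟩ := (continuous_iff_continuousAt.2 fun q => (hgd q).continuousAt).exists_forall_le
    hcoer
  have hq0 := IsLocalMin.hasDerivAt_eq_zero (Filter.Eventually.of_forall hq) (hgd q)
  have hPsum : ∑ i, a i ^ q / S q = 1 := by
    rw [← Finset.sum_div]
    exact div_self (hSpos q).ne'
  have hE : ∑ i, a i ^ q / S q * -Real.log (a i) = β + ε * (2 * q) := by
    have : ∑ i, a i ^ q / S q * -Real.log (a i) = -((∑ i, a i ^ q * Real.log (a i)) / S q) := by
      rw [Finset.sum_div, ← Finset.sum_neg_distrib]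
      exact Finset.sum_congr rfl fun i _ => by ring
    linarith
  have hH : ∑ i, Real.negMulLog (a i ^ q / S q) =
      q * ∑ i, a i ^ q / S q * -Real.log (a i) + Real.log (S q) := by
    have : Real.log (S q) = ∑ i, a i ^ q / S q * Real.log (S q) := by
      rw [← Finset.sum_mul, hPsum, one_mul]
    rw [this, Finset.mul_sum, ← Finset.sum_add_distrib]
    refine Finset.sum_congr rfl fun i _ => ?_
    rw [Real.negMulLog, Real.log_div (Real.rpow_pos_of_pos (ha i) q).ne' (hSpos q).ne',
      Real.log_rpow (ha i)]
    ring
  refine ⟨fun i => a i ^ q / S q, ⟨fun i => ?_, hPsum⟩, ?_, ?_⟩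
  · exact div_nonneg (Real.rpow_nonneg (ha i).le _) (hSpos q).le
  · rw [hH, hE]
    have := hm q
    nlinarith [mul_nonneg hε.le (sq_nonneg q)]
  · rw [hE]
    have h0 : g q ≤ Real.log (Fintype.card ι) := by simpa [hg, hS] using hq 0
    have h1 := hm q
    have h2 : ε * q ^ 2 ≤ Real.log (Fintype.card ι) - m := by
      simp only [hg] at h0
      linarith
    nlinarith

theorem exists_entropy_vector {ι : Type*} [Fintype ι] [Nonempty ι] {a : ι → ℝ}
    (ha : ∀ i, 0 < a i) {β m : ℝ} (hm : ∀ q : ℝ, m ≤ β * q + Real.log (∑ i, a i ^ q)) :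
    ∃ P ∈ stdSimplex ℝ ι, m ≤ ∑ i, Real.negMulLog (P i) ∧ ∑ i, P i * -Real.log (a i) = β := by
  have hK : IsCompact {P ∈ stdSimplex ℝ ι | m ≤ ∑ i, Real.negMulLog (P i)} :=
    (isCompact_stdSimplex ℝ ι).inter_right (isClosed_le continuous_const
      (continuous_finsetSum _ fun i _ => Real.continuous_negMulLog.comp (continuous_apply i)))
  obtain ⟨P₀, hP₀, hm₀, -⟩ := exists_gibbs_vector ha hm one_pos
  obtain ⟨P, ⟨hP, hmP⟩, hmin⟩ := hK.exists_isMinOn ⟨P₀, hP₀, hm₀⟩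
    (f := fun P => (∑ i, P i * -Real.log (a i) - β) ^ 2) (by fun_prop)
  refine ⟨P, hP, hmP, ?_⟩
  have hle : (∑ i, P i * -Real.log (a i) - β) ^ 2 ≤ 0 := by
    refine ge_of_tendsto (f := fun ε => 4 * (Real.log (Fintype.card ι) - m) * ε) (x := 𝓝[>] 0) ?_ ?_
    · exact ((continuous_const_mul _).tendsto' 0 0 (by simp)).mono_left nhdsWithin_le_nhds
    · filter_upwards [self_mem_nhdsWithin] with ε hε
      obtain ⟨Q, hQ, hmQ, hle⟩ := exists_gibbs_vector ha hm hε
      exact (hmin ⟨hQ, hmQ⟩).trans hle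
  linarith [pow_eq_zero_iff two_ne_zero |>.1 (le_antisymm hle (sq_nonneg _))]

/-- A probability vector of entropy at least `leg (theta c a) α` whose mean exponent is `α`. -/
theorem exists_prob_of_bddBelow {c : ℕ} (hc : 2 ≤ c) {a : ℕ → ℝ} (ha : ∀ i < c, 0 < a i) {α : ℝ}
    (hbdd : BddBelow (range fun y => α * y + theta c a y)) :
    ∃ P : ℕ → ℝ, (∀ j < c, 0 ≤ P j) ∧ ∑ j ∈ Finset.range c, P j = 1 ∧
      ∑ j ∈ Finset.range c, P j * -Real.log (a j) = α * Real.log c ∧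
      leg (theta c a) α * Real.log c ≤ ∑ j ∈ Finset.range c, P j * -Real.log (P j) := by
  have : Nonempty (Fin c) := ⟨⟨0, by omega⟩⟩
  have hlog : 0 < Real.log c := Real.log_pos (by exact_mod_cast hc)
  have hm : ∀ q : ℝ, leg (theta c a) α * Real.log c ≤
      α * Real.log c * q + Real.log (∑ i : Fin c, a i ^ q) := by
    intro q
    have := mul_le_mul_of_nonneg_right (ciInf_le hbdd q) hlog.le
    refine this.trans_eq ?_
    simp only [theta, Real.logb]
    rw [Fin.sum_univ_eq_sum_range (fun i => a i ^ q), add_mul, div_mul_cancel₀ _ hlog.ne']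
    ring
  obtain ⟨P, hP, h1, h2⟩ := exists_entropy_vector (a := fun i : Fin c => a i)
    (fun i => ha i i.isLt) hm
  refine ⟨fun j => if h : j < c then P ⟨j, h⟩ else 0, fun j hj => by simp [hj, hP.1], ?_, ?_, ?_⟩
  · rw [← hP.2, ← Fin.sum_univ_eq_sum_range]
    simp
  · rw [← h2, ← Fin.sum_univ_eq_sum_range
      (fun j => (if h : j < c then P ⟨j, h⟩ else 0) * -Real.log (a j))]
    simp
  · rw [← Fin.sum_univ_eq_sum_range (fun j => (if h : j < c then P ⟨j, h⟩ else 0) *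
      -Real.log (if h : j < c then P ⟨j, h⟩ else 0))]
    simpa [Real.negMulLog] using h1

theorem lt_one_of_entropy_pos {c : ℕ} {P : ℕ → ℝ} (hP : ∀ j < c, 0 ≤ P j)
    (hsum : ∑ j ∈ Finset.range c, P j = 1)
    (hH : 0 < ∑ j ∈ Finset.range c, P j * -Real.log (P j)) {j : ℕ} (hj : j < c) : P j < 1 := by
  by_contra! h
  have hz : ∀ i ∈ Finset.range c, i ≠ j → P i = 0 := by
    intro i hi hij
    have h1 := Finset.add_sum_erase _ P (Finset.mem_range.2 hj)
    have h2 := Finset.single_le_sum (f := P) (s := (Finset.range c).erase j)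
      (fun k hk => hP k (Finset.mem_range.1 (Finset.mem_of_mem_erase hk)))
      (Finset.mem_erase.2 ⟨hij, hi⟩)
    linarith [hP i (Finset.mem_range.1 hi)]
  have h1 : P j = 1 := by
    rw [← hsum]
    exact (Finset.sum_eq_single_of_mem j (Finset.mem_range.2 hj) hz).symm
  refine hH.ne' (Finset.sum_eq_zero fun i hi => ?_)
  by_cases hij : i = j
  · simp [hij, h1]
  · simp [hz i hi hij]

theorem Ncount_succ (T : ℕ → ℕ) (n : ℕ) :
    Ncount T (n + 1) = if isA T (n + 1) then Ncount T n + 1 else Ncount T n := by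
  rw [Ncount, Ncount, ← Finset.insert_Icc_right_eq_Icc_add_one (by omega), Finset.filter_insert]
  split_ifs
  · rw [Finset.card_insert_of_notMem (by simp)]
  · rfl

theorem Ncount_le (T : ℕ → ℕ) (n : ℕ) : Ncount T n ≤ n :=
  (Finset.card_filter_le _ _).trans (by simp)

theorem prod_range_ite_isA {M : Type*} [CommMonoid M] (T : ℕ → ℕ) (A B : M) (n : ℕ) :
    ∏ i ∈ Finset.range n, (if isA T (i + 1) then A else B) =
      A ^ Ncount T n * B ^ (n - Ncount T n) := by
  induction n with
  | zero => simp [Ncount]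
  | succ n ih =>
    have := Ncount_le T n
    rw [Finset.prod_range_succ, ih, Ncount_succ]
    split_ifs
    · rw [Nat.add_sub_add_right, pow_succ]
      exact mul_right_comm _ _ _
    · rw [Nat.sub_add_comm this, pow_succ, mul_assoc]

theorem Ncount_le_of_forall_not {T : ℕ → ℕ} {t n : ℕ} (h : ∀ j, t ≤ j → j ≤ n → ¬isA T j) :
    Ncount T n ≤ t := by
  have : (Finset.Icc 1 n).filter (isA T) ⊆ Finset.range t := by
    intro j hj
    simp only [Finset.mem_filter, Finset.mem_Icc] at hj
    by_contra hjt
    exact h j (by simpa using hjt) hj.1.2 hj.2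
  exact (Finset.card_le_card this).trans (Finset.card_range t).le

theorem sub_Ncount_le_of_forall {T : ℕ → ℕ} {t n : ℕ} (ht : 1 ≤ t)
    (h : ∀ j, t ≤ j → j ≤ n → isA T j) : n - Ncount T n ≤ t := by
  have : Finset.Icc t n ⊆ (Finset.Icc 1 n).filter (isA T) := by
    intro j hj
    simp only [Finset.mem_filter, Finset.mem_Icc] at hj ⊢
    exact ⟨⟨ht.trans hj.1, hj.2⟩, h j hj.1 hj.2⟩
  have := Finset.card_le_card this
  rw [Nat.card_Icc] at this
  change _ ≤ Ncount T n at this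
  omega

section Blocks

variable {T : ℕ → ℕ}

theorem le_of_forall_lt_succ (hT : ∀ k, 1 ≤ k → T k < T (k + 1)) {i j : ℕ} (hi : 1 ≤ i)
    (hij : i ≤ j) : T i ≤ T j := by
  induction j, hij using Nat.le_induction with
  | base => exact le_rfl
  | succ j hj ih => exact ih.trans (hT j (hi.trans hj)).le

theorem le_block_end (hT1 : T 1 = 1) (hT : ∀ k, 1 ≤ k → T k < T (k + 1)) {k : ℕ} (hk : 1 ≤ k) :
    k ≤ T k := by
  induction k, hk using Nat.le_induction with
  | base => exact hT1.ge
  | succ k hk ih => exact ih.trans_lt (hT k hk)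

theorem eventually_block_start_le (hT1 : T 1 = 1) (hT : ∀ k, 1 ≤ k → T k < T (k + 1))
    (hTrat : Tendsto (fun k => (T (k + 1) : ℝ) / (T k : ℝ)) atTop atTop) {δ : ℝ} (hδ : 0 < δ) :
    ∀ᶠ k in atTop, (T k : ℝ) ≤ δ * ((T (k + 1) - 1 : ℕ) : ℝ) := by
  filter_upwards [hTrat.eventually_ge_atTop (2 / δ), eventually_ge_atTop 1] with k hk hk1
  have h1 : 1 ≤ T k := hk1.trans (le_block_end hT1 hT hk1)
  have h2 := hT k hk1
  have h1' : (0 : ℝ) < T k := by exact_mod_cast h1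
  rw [div_le_div_iff₀ hδ h1'] at hk
  have h3 : (2 : ℝ) ≤ T (k + 1) := by exact_mod_cast (by omega : 2 ≤ T (k + 1))
  rw [Nat.cast_sub (by omega)]
  push_cast
  nlinarith

theorem frequently_sub_Ncount_le (hT1 : T 1 = 1) (hT : ∀ k, 1 ≤ k → T k < T (k + 1))
    (hTrat : Tendsto (fun k => (T (k + 1) : ℝ) / (T k : ℝ)) atTop atTop) {δ : ℝ} (hδ : 0 < δ) :
    ∃ᶠ n in atTop, ((n - Ncount T n : ℕ) : ℝ) ≤ δ * n := by
  rw [frequently_atTop]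
  intro n₀
  obtain ⟨k₀, hk₀⟩ := eventually_atTop.1 (eventually_block_start_le hT1 hT hTrat hδ)
  set k := k₀ + n₀ + 1
  have h := hk₀ (2 * k - 1) (by omega)
  rw [show 2 * k - 1 + 1 = 2 * k by omega] at h
  have h1 := le_block_end hT1 hT (k := 2 * k) (by omega)
  have h2 := le_block_end hT1 hT (k := 2 * k - 1) (by omega)
  refine ⟨T (2 * k) - 1, by omega, le_trans ?_ h⟩
  exact_mod_cast sub_Ncount_le_of_forall (by omega) fun j h1 h2 => ⟨k, by omega, h1, by omega⟩

theorem frequently_Ncount_le (hT1 : T 1 = 1) (hT : ∀ k, 1 ≤ k → T k < T (k + 1))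
    (hTrat : Tendsto (fun k => (T (k + 1) : ℝ) / (T k : ℝ)) atTop atTop) {δ : ℝ} (hδ : 0 < δ) :
    ∃ᶠ n in atTop, (Ncount T n : ℝ) ≤ δ * n := by
  rw [frequently_atTop]
  intro n₀
  obtain ⟨k₀, hk₀⟩ := eventually_atTop.1 (eventually_block_start_le hT1 hT hTrat hδ)
  set k := k₀ + n₀ + 1
  have h := hk₀ (2 * k) (by omega)
  have h1 := le_block_end hT1 hT (k := 2 * k + 1) (by omega)
  refine ⟨T (2 * k + 1) - 1, by omega, le_trans ?_ h⟩
  refine Nat.cast_le.2 (Ncount_le_of_forall_not fun j h2 h3 => ?_)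
  rintro ⟨i, hi, h4, h5⟩
  rcases le_or_gt i k with hik | hik
  · have := le_of_forall_lt_succ hT (i := 2 * i) (j := 2 * k) (by omega) (by omega)
    omega
  · have := le_of_forall_lt_succ hT (i := 2 * k + 1) (j := 2 * i - 1) (by omega) (by omega)
    omega

end Blocks

theorem frequently_pow_mul_pow_le {c d : ℕ} (hc : 2 ≤ c) (hd : 2 ≤ d) {A B : ℝ} (hA : 0 < A)
    (hB : 0 < B) {M : ℕ → ℕ} (hM : ∀ n, M n ≤ n)
    (hfreq : ∀ δ > 0, ∃ᶠ n in atTop, (M n : ℝ) ≤ δ * n) {ε : ℝ} (hε : 0 < ε) :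
    ∃ᶠ n in atTop, A ^ (n - M n) * B ^ M n ≤
      (((c : ℝ) ^ (n - M n) * (d : ℝ) ^ M n)⁻¹) ^ (-(Real.logb c A + ε)) := by
  set t := Real.logb c A with ht
  have hc0 : (0 : ℝ) < c := by positivity
  have hd0 : (0 : ℝ) < d := by positivity
  have hlogc : Real.log 2 ≤ Real.log c := Real.log_le_log two_pos (by exact_mod_cast hc)
  have hlogd : Real.log 2 ≤ Real.log d := Real.log_le_log two_pos (by exact_mod_cast hd)
  have hlog2 : 0 < Real.log 2 := Real.log_pos one_lt_two
  have htA : Real.log A = t * Real.log c := by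
    rw [ht, Real.logb, div_mul_cancel₀ _ (hlog2.trans_le hlogc).ne']
  set K := |Real.log B - t * Real.log d| + 1 with hK
  have hK0 : 0 < K := by positivity
  refine (hfreq (ε * Real.log 2 / K) (by positivity)).mono fun n hn => ?_
  rw [Real.rpow_neg (by positivity), Real.inv_rpow (by positivity), inv_inv,
    ← Real.log_le_log_iff (by positivity) (by positivity), Real.log_rpow (by positivity),
    Real.log_mul (by positivity) (by positivity), Real.log_mul (by positivity) (by positivity),
    Real.log_pow, Real.log_pow, Real.log_pow, Real.log_pow, htA, Nat.cast_sub (hM n)]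
  have hMn : (M n : ℝ) ≤ n := by exact_mod_cast hM n
  have h1 : (M n : ℝ) * (Real.log B - t * Real.log d) ≤ M n * K :=
    mul_le_mul_of_nonneg_left ((le_abs_self _).trans (by linarith)) (by positivity)
  have h2 : M n * K ≤ ε * (Real.log 2 * n) := by
    calc M n * K ≤ ε * Real.log 2 / K * n * K := mul_le_mul_of_nonneg_right hn hK0.le
      _ = ε * (Real.log 2 * n) := by field_simp
  have h3 : Real.log 2 * n ≤ (n - M n) * Real.log c + M n * Real.log d := by
    nlinarith [mul_le_mul_of_nonneg_left hlogc (sub_nonneg.2 hMn),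
      mul_le_mul_of_nonneg_left hlogd (Nat.cast_nonneg (α := ℝ) (M n))]
  nlinarith [mul_le_mul_of_nonneg_left h3 hε.le]

theorem le_ofReal_leg {f : ℝ → ℝ} {x : ℝ} {d : ℝ≥0∞}
    (h : ∀ y, d ≤ ENNReal.ofReal (x * y + f y)) : d ≤ ENNReal.ofReal (leg f x) := by
  by_cases hbdd : BddBelow (range fun y => x * y + f y)
  · refine le_of_forall_gt_imp_ge_of_dense fun s hs => ?_
    rcases eq_or_ne s ∞ with rfl | hs_ne
    · exact le_top
    lift s to ℝ≥0 using hs_ne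
    rcases lt_or_ge (leg f x) s with hlt | hge
    · obtain ⟨y, hy⟩ := exists_lt_of_ciInf_lt hlt
      refine (h y).trans ?_
      rw [← ENNReal.ofReal_coe_nnreal]
      exact ENNReal.ofReal_le_ofReal hy.le
    · refine absurd (ENNReal.ofReal_le_ofReal hge) (not_le.2 ?_)
      simpa using hs
  · obtain ⟨_, ⟨y, rfl⟩, hy⟩ := not_bddBelow_iff.1 hbdd 0
    rw [nonpos_iff_eq_zero.1 ((h y).trans_eq (ENNReal.ofReal_of_nonpos hy.le))]
    exact zero_le

theorem bddBelow_of_leg_pos {f : ℝ → ℝ} {x : ℝ} (h : 0 < leg f x) :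
    BddBelow (range fun y => x * y + f y) := by
  by_contra hbdd
  exact h.ne' (Real.iInf_of_not_bddBelow hbdd)

theorem exists_uniform_lt_one {c d : ℕ} {P Q : ℕ → ℝ} (hP : ∀ j < c, P j < 1)
    (hQ : ∀ j < d, Q j < 1) :
    ∃ ρ : ℝ, 0 < ρ ∧ ρ < 1 ∧ (∀ j < c, P j ≤ ρ) ∧ ∀ j < d, Q j ≤ ρ := by
  have h : ∀ (c : ℕ) (P : ℕ → ℝ), (∀ j < c, P j < 1) → ∀ᶠ ρ in 𝓝[<] (1 : ℝ), ∀ j < c, P j ≤ ρ := by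
    intro c P hP
    have : ∀ᶠ ρ in 𝓝[<] (1 : ℝ), ∀ j ∈ Finset.range c, P j ≤ ρ :=
      (Finset.eventually_all _).2 fun j hj =>
        (eventually_ge_nhds (hP j (Finset.mem_range.1 hj))).filter_mono nhdsWithin_le_nhds
    simpa using this
  obtain ⟨ρ, h1, h2, h3⟩ :=
    (Filter.Eventually.and (Ioo_mem_nhdsLT one_pos) ((h c P hP).and (h d Q hQ))).exists
  exact ⟨ρ, h1.1, h1.2, h2, h3⟩

theorem exists_uniform_abs_le (c : ℕ) (f : ℕ → ℝ) : ∃ B, 0 ≤ B ∧ ∀ j < c, |f j| ≤ B :=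
  ⟨∑ j ∈ Finset.range c, |f j|, by positivity, fun _ hj =>
    Finset.single_le_sum (f := fun j => |f j|) (fun _ _ => abs_nonneg _) (Finset.mem_range.2 hj)⟩

theorem digitScale_Yc (c₁ c₂ : ℕ) (T : ℕ → ℕ) (n : ℕ) :
    digitScale (Yc c₁ c₂ T) n = Dw c₁ c₂ T n := by
  rw [Dw, digitScale, mul_inv, ← inv_pow, ← inv_pow, ← prod_range_ite_isA]
  refine Finset.prod_congr rfl fun i _ => ?_
  rw [Yc]
  split_ifs <;> rfl

theorem gammaMap_eq_digitPoint (c₁ c₂ : ℕ) (T : ℕ → ℕ) :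
    gammaMap c₁ c₂ T = digitPoint (Yc c₁ c₂ T) := by
  funext x
  simp only [gammaMap, digitPoint, digitScale_Yc]

theorem cyl_eq_digitCyl (c₁ c₂ : ℕ) (T : ℕ → ℕ) (x : Omg c₁ c₂ T) (n : ℕ) :
    cyl c₁ c₂ T n (fun i => x i) = digitCyl (Yc c₁ c₂ T) x n := by
  ext z
  simp [cyl, digitCyl, Fin.forall_iff]

theorem dimH_Xlev_le_min (c₁ c₂ : ℕ) (hc₁ : 2 ≤ c₁) (hc₂ : 2 ≤ c₂)
    (T : ℕ → ℕ) (hT1 : T 1 = 1) (hTmono : ∀ k, 1 ≤ k → T k < T (k + 1))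
    (hTrat : Tendsto (fun k => (T (k + 1) : ℝ) / (T k : ℝ)) atTop atTop)
    (a b : ℕ → ℝ) (ha : ∀ i < c₁, 0 < a i) (hb : ∀ j < c₂, 0 < b j)
    (μ : Measure (Omg c₁ c₂ T)) [IsProbabilityMeasure μ]
    (hμ : ∀ x n, μ (digitCyl (Yc c₁ c₂ T) x n) =
      ENNReal.ofReal (∏ i ∈ Finset.range n, if isA T (i + 1) then a (x i) else b (x i))) (α : ℝ) :
    dimH (Xlev (μ.map (digitPoint (Yc c₁ c₂ T))) α) ≤
      ENNReal.ofReal (min (leg (theta c₁ a) α) (leg (theta c₂ b) α)) := by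
  have hY : ∀ n, 2 ≤ Yc c₁ c₂ T n := fun n => by
    rw [Yc]
    split_ifs <;> assumption
  have hwt : ∀ n j, j < Yc c₁ c₂ T n → 0 < if isA T (n + 1) then a j else b j := by
    intro n j hj
    by_cases h : isA T (n + 1) <;> simp only [Yc, h, if_true, if_false] at hj ⊢
    exacts [ha j hj, hb j hj]
  have hprod : ∀ n (y : ℝ), ∏ i ∈ Finset.range n, ∑ j ∈ Finset.range (Yc c₁ c₂ T i),
      (if isA T (i + 1) then a j else b j) ^ y =
      (∑ j ∈ Finset.range c₁, a j ^ y) ^ Ncount T n *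
        (∑ j ∈ Finset.range c₂, b j ^ y) ^ (n - Ncount T n) := by
    intro n y
    rw [← prod_range_ite_isA]
    refine Finset.prod_congr rfl fun i _ => ?_
    by_cases h : isA T (i + 1) <;> simp only [Yc, h, if_true, if_false]
  have hpos : ∀ (c : ℕ) (a : ℕ → ℝ), 2 ≤ c → (∀ i < c, 0 < a i) → ∀ y : ℝ,
      0 < ∑ j ∈ Finset.range c, a j ^ y := fun c a hc ha y =>
    Finset.sum_pos (fun i hi => Real.rpow_pos_of_pos (ha i (Finset.mem_range.1 hi)) y)
      (Finset.nonempty_range_iff.2 (by omega))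
  rw [(ENNReal.ofReal_mono).map_min]
  refine le_min (le_ofReal_leg fun y => ?_) (le_ofReal_leg fun y => ?_)
  · refine dimH_Xlev_le hY hwt μ hμ α y _ fun ε hε => ?_
    refine (frequently_pow_mul_pow_le hc₁ hc₂ (hpos c₁ a hc₁ ha y) (hpos c₂ b hc₂ hb y)
      (M := fun n => n - Ncount T n) (fun n => Nat.sub_le _ _)
      (fun δ hδ => frequently_sub_Ncount_le hT1 hTmono hTrat hδ) hε).mono fun n hn => ?_
    rw [Nat.sub_sub_self (Ncount_le T n)] at hn
    rwa [hprod, digitScale_Yc]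
  · refine dimH_Xlev_le hY hwt μ hμ α y _ fun ε hε => ?_
    refine (frequently_pow_mul_pow_le hc₂ hc₁ (hpos c₂ b hc₂ hb y) (hpos c₁ a hc₁ ha y)
      (Ncount_le T) (fun δ hδ => frequently_Ncount_le hT1 hTmono hTrat hδ) hε).mono fun n hn => ?_
    rw [hprod, digitScale_Yc, Dw, mul_comm, mul_comm ((c₁ : ℝ) ^ _)]
    exact hn

theorem min_le_dimH_Xlev (c₁ c₂ : ℕ) (hc₁ : 2 ≤ c₁) (hc₂ : 2 ≤ c₂)
    (T : ℕ → ℕ) (a b : ℕ → ℝ) (ha : ∀ i < c₁, 0 < a i) (hb : ∀ j < c₂, 0 < b j)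
    (μ : Measure (Omg c₁ c₂ T)) [IsProbabilityMeasure μ]
    (hμ : ∀ x n, μ (digitCyl (Yc c₁ c₂ T) x n) =
      ENNReal.ofReal (∏ i ∈ Finset.range n, if isA T (i + 1) then a (x i) else b (x i))) (α : ℝ) :
    ENNReal.ofReal (min (leg (theta c₁ a) α) (leg (theta c₂ b) α)) ≤
      dimH (Xlev (μ.map (digitPoint (Yc c₁ c₂ T))) α) := by
  set L := min (leg (theta c₁ a) α) (leg (theta c₂ b) α) with hLdef
  rcases le_or_gt L 0 with hL | hL
  · simp [ENNReal.ofReal_of_nonpos hL]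
  have hLa : L ≤ leg (theta c₁ a) α := min_le_left _ _
  have hLb : L ≤ leg (theta c₂ b) α := min_le_right _ _
  obtain ⟨P, hP0, hP1, hPα, hPH⟩ :=
    exists_prob_of_bddBelow hc₁ ha (bddBelow_of_leg_pos (hL.trans_le hLa))
  obtain ⟨Q, hQ0, hQ1, hQα, hQH⟩ :=
    exists_prob_of_bddBelow hc₂ hb (bddBelow_of_leg_pos (hL.trans_le hLb))
  have hlog₁ : 0 < Real.log c₁ := Real.log_pos (by exact_mod_cast hc₁)
  have hlog₂ : 0 < Real.log c₂ := Real.log_pos (by exact_mod_cast hc₂)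
  replace hPH := (mul_le_mul_of_nonneg_right hLa hlog₁.le).trans hPH
  replace hQH := (mul_le_mul_of_nonneg_right hLb hlog₂.le).trans hQH
  obtain ⟨ρ, hρ0, hρ1, hρP, hρQ⟩ := exists_uniform_lt_one
    (fun j hj => lt_one_of_entropy_pos hP0 hP1 ((mul_pos hL hlog₁).trans_le hPH) hj)
    (fun j hj => lt_one_of_entropy_pos hQ0 hQ1 ((mul_pos hL hlog₂).trans_le hQH) hj)
  obtain ⟨B₁, hB₁, h₁⟩ := exists_uniform_abs_le c₁ fun j => Real.log (a j)
  obtain ⟨B₂, hB₂, h₂⟩ := exists_uniform_abs_le c₂ fun j => Real.log (b j)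
  obtain ⟨B₃, hB₃, h₃⟩ := exists_uniform_abs_le c₁ fun j => Real.log (P j)
  obtain ⟨B₄, hB₄, h₄⟩ := exists_uniform_abs_le c₂ fun j => Real.log (Q j)
  refine ofReal_le_dimH_Xlev (C := max c₁ c₂) (B := B₁ + B₂ + B₃ + B₄) (ρ := ρ) (α := α) (L := L)
    (wt := fun n j => if isA T (n + 1) then a j else b j)
    (p := fun n j => if isA T (n + 1) then P j else Q j)
    ?_ ?_ ?_ ?_ ?_ ?_ ?_ hρ0 hρ1 ?_ μ hμ ?_ ?_ <;> intro n <;>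
    by_cases h : isA T (n + 1) <;> simp only [Yc, h, if_true, if_false]
  · exact hc₁
  · exact hc₂
  · exact le_max_left _ _
  · exact le_max_right _ _
  · exact ha
  · exact hb
  · exact fun j hj => (h₁ j hj).trans (by linarith)
  · exact fun j hj => (h₂ j hj).trans (by linarith)
  · exact hP0
  · exact hQ0
  · exact hP1
  · exact hQ1
  · exact fun j hj => (h₃ j hj).trans (by linarith)
  · exact fun j hj => (h₄ j hj).trans (by linarith)
  · exact hρP
  · exact hρQ
  · exact hPα
  · exact hQα
  · exact hPH
  · exact hQH

/-- `dim X_ν(α) = min(θ_a^*(α), θ_b^*(α))`. -/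
theorem stmt13 (c₁ c₂ : ℕ) (hc₁ : 2 ≤ c₁) (hc₂ : 2 ≤ c₂)
    (T : ℕ → ℕ) (hT1 : T 1 = 1) (hTmono : ∀ k, 1 ≤ k → T k < T (k + 1))
    (hTrat : Tendsto (fun k => (T (k + 1) : ℝ) / (T k : ℝ)) atTop atTop)
    (a b : ℕ → ℝ) (ha : ∀ i, i < c₁ → 0 < a i ∧ a i < 1)
    (hb : ∀ j, j < c₂ → 0 < b j ∧ b j < 1)
    (hsa : ∑ i ∈ Finset.range c₁, a i = 1) (hsb : ∑ j ∈ Finset.range c₂, b j = 1)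
    (μ : Measure (Omg c₁ c₂ T)) [IsProbabilityMeasure μ]
    (hμ : ∀ (n : ℕ) (w : Word c₁ c₂ T n),
      μ (cyl c₁ c₂ T n w) = ENNReal.ofReal (cylWeight c₁ c₂ T a b n w))
    (α : ℝ) (hα1 : -Real.log (sOne c₁ c₂ a b) < α) (hα2 : α < -Real.log (sTwo c₁ c₂ a b)) :
    dimH (Xlev (μ.map (gammaMap c₁ c₂ T)) α) =
      ENNReal.ofReal (min (leg (theta c₁ a) α) (leg (theta c₂ b) α)) := by
  have hμ' : ∀ (x : Omg c₁ c₂ T) n, μ (digitCyl (Yc c₁ c₂ T) x n) =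
      ENNReal.ofReal (∏ i ∈ Finset.range n, if isA T (i + 1) then a (x i) else b (x i)) := by
    intro x n
    rw [← cyl_eq_digitCyl, hμ, cylWeight,
      ← Fin.prod_univ_eq_prod_range (fun i => if isA T (i + 1) then a (x i) else b (x i))]
  rw [gammaMap_eq_digitPoint]
  exact le_antisymm
    (dimH_Xlev_le_min c₁ c₂ hc₁ hc₂ T hT1 hTmono hTrat a b (fun i hi => (ha i hi).1)
      (fun j hj => (hb j hj).1) μ hμ' α)
    (min_le_dimH_Xlev c₁ c₂ hc₁ hc₂ T a b (fun i hi => (ha i hi).1)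
      (fun j hj => (hb j hj).1) μ hμ' α)

end MF
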